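/- There exist absolute constants C₀, C_d, C_T > 0 such that the following holds. Let M ∈ ℝ^{m×n} (m ≥ n) be a rank-r μ-incoherent matrix, α = m/n, κ = Σmax/Σmin, δ = Σmin/(C_d·r^{3/2}·κ). Let Ω be drawn uniformly at random among all subsets of [m]×[n] of cardinality S with S ≥ C₀·α·n·r·κ²·max{μ·log n, √α·μ²·r⁶·κ⁴}, and p = S/(mn). Then with probability at least 1 − 1/(2n⁴): for every (X,Y) ∈ K₁ ∩ K₂ ∩ K(δ) one has (1/3)·p·‖M − X·Yᵀ‖_F² ≤ ‖P_Ω(M − X·Yᵀ)‖_F² ≤ 2·p·‖M − X·Yᵀ‖_F². -/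

import Mathlib

open Matrix
open scoped Classical

noncomputable section

/-- Frobenius norm of a real matrix. -/
def frob {m n : ℕ} (A : Matrix (Fin m) (Fin n) ℝ) : ℝ :=
  Real.sqrt (∑ i, ∑ j, A i j ^ 2)

/-- Euclidean norm of the `i`-th row of a matrix. -/
def rowNorm {m n : ℕ} (A : Matrix (Fin m) (Fin n) ℝ) (i : Fin m) : ℝ :=
  Real.sqrt (∑ j, A i j ^ 2)

/-- Frobenius inner product `⟨A,B⟩ = trace(AᵀB)`. -/
def finner {m n : ℕ} (A B : Matrix (Fin m) (Fin n) ℝ) : ℝ :=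
  ∑ i, ∑ j, A i j * B i j

/-- Projection onto the set of entries indexed by `Ω` (other entries are set to `0`). -/
def projOmega {m n : ℕ} (Ω : Finset (Fin m × Fin n)) (A : Matrix (Fin m) (Fin n) ℝ) :
    Matrix (Fin m) (Fin n) ℝ :=
  Matrix.of fun i j => if (i, j) ∈ Ω then A i j else 0

/-- `G₀(z) = (max{0, z-1})²`. -/
def G0 (z : ℝ) : ℝ := max 0 (z - 1) ^ 2

/-- `G₀′(z) = 2·max{0, z-1}`. -/
def G0' (z : ℝ) : ℝ := 2 * max 0 (z - 1)

/-- The matrix whose `i`-th row is the `i`-th row of `A` and whose other rows vanish. -/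
def rowMat {m n : ℕ} (A : Matrix (Fin m) (Fin n) ℝ) (i : Fin m) :
    Matrix (Fin m) (Fin n) ℝ :=
  Matrix.of fun i' j => if i' = i then A i j else 0

/-- The regularizer `G(X,Y)`. -/
def Greg {m n r : ℕ} (ρ β1 β2 βT : ℝ) (X : Matrix (Fin m) (Fin r) ℝ)
    (Y : Matrix (Fin n) (Fin r) ℝ) : ℝ :=
  ρ * ∑ i, G0 (3 * rowNorm X i ^ 2 / (2 * β1 ^ 2)) +
    ρ * ∑ j, G0 (3 * rowNorm Y j ^ 2 / (2 * β2 ^ 2)) +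
    ρ * G0 (3 * frob X ^ 2 / (2 * βT ^ 2)) +
    ρ * G0 (3 * frob Y ^ 2 / (2 * βT ^ 2))

/-- The regularized objective `F̃(X,Y)`. -/
def Ftilde {m n r : ℕ} (Ω : Finset (Fin m × Fin n)) (M : Matrix (Fin m) (Fin n) ℝ)
    (ρ β1 β2 βT : ℝ) (X : Matrix (Fin m) (Fin r) ℝ) (Y : Matrix (Fin n) (Fin r) ℝ) : ℝ :=
  (1 / 2) * frob (projOmega Ω (M - X * Yᵀ)) ^ 2 + Greg ρ β1 β2 βT X Y

/-- Gradient of the regularizer with respect to one of the factors. -/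
def gradG1 {m r : ℕ} (ρ β βT : ℝ) (X : Matrix (Fin m) (Fin r) ℝ) :
    Matrix (Fin m) (Fin r) ℝ :=
  (∑ i, (ρ * G0' (3 * rowNorm X i ^ 2 / (2 * β ^ 2)) * (3 / β ^ 2)) • rowMat X i) +
    (ρ * G0' (3 * frob X ^ 2 / (2 * βT ^ 2)) * (3 / βT ^ 2)) • X

/-- `∇_X F̃(X,Y)`. -/
def gradX {m n r : ℕ} (Ω : Finset (Fin m × Fin n)) (M : Matrix (Fin m) (Fin n) ℝ)
    (ρ β1 βT : ℝ) (X : Matrix (Fin m) (Fin r) ℝ) (Y : Matrix (Fin n) (Fin r) ℝ) :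
    Matrix (Fin m) (Fin r) ℝ :=
  projOmega Ω (X * Yᵀ - M) * Y + gradG1 ρ β1 βT X

/-- `∇_Y F̃(X,Y)`. -/
def gradY {m n r : ℕ} (Ω : Finset (Fin m × Fin n)) (M : Matrix (Fin m) (Fin n) ℝ)
    (ρ β2 βT : ℝ) (X : Matrix (Fin m) (Fin r) ℝ) (Y : Matrix (Fin n) (Fin r) ℝ) :
    Matrix (Fin n) (Fin r) ℝ :=
  (projOmega Ω (X * Yᵀ - M))ᵀ * X + gradG1 ρ β2 βT Y

/-- Membership in `K₁`. -/
def K1mem {m n r : ℕ} (β1 β2 : ℝ) (X : Matrix (Fin m) (Fin r) ℝ)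
    (Y : Matrix (Fin n) (Fin r) ℝ) : Prop :=
  (∀ i, rowNorm X i ≤ β1) ∧ ∀ j, rowNorm Y j ≤ β2

/-- Membership in `K₂`. -/
def K2mem {m n r : ℕ} (βT : ℝ) (X : Matrix (Fin m) (Fin r) ℝ)
    (Y : Matrix (Fin n) (Fin r) ℝ) : Prop :=
  frob X ≤ βT ∧ frob Y ≤ βT

/-- Membership in `K(t) = {(X,Y) : ‖M - XYᵀ‖_F ≤ t}`. -/
def Kmem {m n r : ℕ} (M : Matrix (Fin m) (Fin n) ℝ) (t : ℝ)
    (X : Matrix (Fin m) (Fin r) ℝ) (Y : Matrix (Fin n) (Fin r) ℝ) : Prop :=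
  frob (M - X * Yᵀ) ≤ t

lemma aux_binom_mode (N S k : ℕ) (hS : S ≤ N) (hk : k ≤ N) :
    N.choose k * (S ^ k * (N - S) ^ (N - k)) ≤ N.choose S * (S ^ S * (N - S) ^ (N - S)) := by
  rcases le_total k S with h | h
  · have key : N.choose k * (N - S) ^ (S - k) ≤ N.choose S * S ^ (S - k) := by
      have e1 := Nat.choose_mul_factorial_mul_factorial hk
      have e2 := Nat.choose_mul_factorial_mul_factorial hS
      have h1 : S.factorial ≤ k.factorial * S ^ (S - k) := by
        have := Nat.factorial_mul_descFactorial (n := S) (k := S - k) (by omega)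
        rw [Nat.sub_sub_self h] at this
        rw [← this]
        exact Nat.mul_le_mul_left _ (Nat.descFactorial_le_pow _ _)
      have h2 : (N - S).factorial * (N - S) ^ (S - k) ≤ (N - k).factorial := by
        have := Nat.factorial_mul_pow_sub_le_factorial (n := N - S) (m := N - k) (by omega)
        rwa [show N - k - (N - S) = S - k by omega] at this
      have hpos : 0 < k.factorial * (N - k).factorial * ((N - S).factorial) := by positivity
      refine Nat.le_of_mul_le_mul_left ?_ hpos
      calc k.factorial * (N - k).factorial * (N - S).factorial * (N.choose k * (N - S) ^ (S - k))
          = N.factorial * ((N - S).factorial * (N - S) ^ (S - k)) := by rw [← e1]; ring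
        _ ≤ N.factorial * (N - k).factorial := Nat.mul_le_mul_left _ h2
        _ = N.choose S * (N - S).factorial * (N - k).factorial * S.factorial := by rw [← e2]; ring
        _ ≤ N.choose S * (N - S).factorial * (N - k).factorial * (k.factorial * S ^ (S - k)) :=
            Nat.mul_le_mul_left _ h1
        _ = _ := by ring
    calc _ = (N.choose k * (N - S) ^ (S - k)) * (S ^ k * (N - S) ^ (N - S)) := by
          rw [show N - k = (S - k) + (N - S) by omega, pow_add]; ring
      _ ≤ (N.choose S * S ^ (S - k)) * (S ^ k * (N - S) ^ (N - S)) := Nat.mul_le_mul_right _ key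
      _ = _ := by
          conv_rhs => rw [show S ^ S = S ^ (S - k) * S ^ k by rw [← pow_add]; congr 1; omega]
          ring
  · have key : N.choose k * S ^ (k - S) ≤ N.choose S * (N - S) ^ (k - S) := by
      have e1 := Nat.choose_mul_factorial_mul_factorial hk
      have e2 := Nat.choose_mul_factorial_mul_factorial hS
      have h1 : (N - S).factorial ≤ (N - k).factorial * (N - S) ^ (k - S) := by
        have := Nat.factorial_mul_descFactorial (n := N - S) (k := k - S) (by omega)
        rw [show N - S - (k - S) = N - k by omega] at this
        rw [← this]
        exact Nat.mul_le_mul_left _ (Nat.descFactorial_le_pow _ _)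
      have h2 : S.factorial * S ^ (k - S) ≤ k.factorial :=
        Nat.factorial_mul_pow_sub_le_factorial h
      have hpos : 0 < k.factorial * (N - k).factorial * (S.factorial) := by positivity
      refine Nat.le_of_mul_le_mul_left ?_ hpos
      calc k.factorial * (N - k).factorial * S.factorial * (N.choose k * S ^ (k - S))
          = N.factorial * (S.factorial * S ^ (k - S)) := by rw [← e1]; ring
        _ ≤ N.factorial * k.factorial := Nat.mul_le_mul_left _ h2
        _ = N.choose S * S.factorial * k.factorial * (N - S).factorial := by rw [← e2]; ring
        _ ≤ N.choose S * S.factorial * k.factorial * ((N - k).factorial * (N - S) ^ (k - S)) :=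
            Nat.mul_le_mul_left _ h1
        _ = _ := by ring
    calc _ = (N.choose k * S ^ (k - S)) * (S ^ S * (N - S) ^ (N - k)) := by
          rw [show S ^ k = S ^ (k - S) * S ^ S by rw [← pow_add]; congr 1; omega]; ring
      _ ≤ (N.choose S * (N - S) ^ (k - S)) * (S ^ S * (N - S) ^ (N - k)) :=
          Nat.mul_le_mul_right _ key
      _ = _ := by
          conv_rhs => rw [show N - S = (k - S) + (N - k) by omega, pow_add]
          rw [show k - S + (N - k) = N - S by omega]
          ring

lemma aux_mode_real (N S : ℕ) (hN : 0 < N) (hS : S ≤ N) :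
    1 ≤ ((N : ℝ) + 1) * ((N.choose S : ℝ) *
      (((S : ℝ) / N) ^ S * (1 - (S : ℝ) / N) ^ (N - S))) := by
  have hN' : (0 : ℝ) < N := by exact_mod_cast hN
  set p : ℝ := (S : ℝ) / N with hp
  have h1p : 1 - p = ((N - S : ℕ) : ℝ) / N := by
    rw [hp, Nat.cast_sub hS]; field_simp
  have hterm : ∀ k ≤ N, p ^ k * (1 - p) ^ (N - k) =
      ((S : ℝ) ^ k * ((N - S : ℕ) : ℝ) ^ (N - k)) / (N : ℝ) ^ N := by
    intro k hk
    rw [h1p, hp, div_pow, div_pow, div_mul_div_comm, ← pow_add]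
    congr 2; omega
  have hb := add_pow p (1 - p) N
  rw [show p + (1 - p) = 1 by ring, one_pow] at hb
  refine hb.le.trans ?_
  have : ∀ k ∈ Finset.range (N + 1), p ^ k * (1 - p) ^ (N - k) * (N.choose k : ℝ) ≤
      (N.choose S : ℝ) * (p ^ S * (1 - p) ^ (N - S)) := by
    intro k hk
    have hk : k ≤ N := by simpa [Nat.lt_succ_iff] using hk
    rw [hterm k hk, hterm S hS]
    have := aux_binom_mode N S k hS hk
    have h' : (N.choose k : ℝ) * ((S : ℝ) ^ k * ((N - S : ℕ) : ℝ) ^ (N - k)) ≤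
      N.choose S * ((S : ℝ) ^ S * ((N - S : ℕ) : ℝ) ^ (N - S)) := by exact_mod_cast this
    rw [div_mul_eq_mul_div, mul_div_assoc', mul_comm]
    gcongr
  calc _ ≤ ∑ k ∈ Finset.range (N + 1), (N.choose S : ℝ) * (p ^ S * (1 - p) ^ (N - S)) :=
        Finset.sum_le_sum this
    _ = _ := by simp

lemma aux_mgf {ι : Type} [Fintype ι] (S : ℕ) (hN : 0 < Fintype.card ι)
    (hS : S ≤ Fintype.card ι) (p : ℝ) (hp : p = (S : ℝ) / Fintype.card ι) (g : ι → ℝ) :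
    ∑ Ω ∈ Finset.powersetCard S (Finset.univ : Finset ι), Real.exp (∑ e ∈ Ω, g e) ≤
      ((Fintype.card ι : ℝ) + 1) *
        ((Finset.powersetCard S (Finset.univ : Finset ι)).card : ℝ) *
        Real.exp (p * ∑ e, (Real.exp (g e) - 1)) := by
  have hN' : (0 : ℝ) < Fintype.card ι := by exact_mod_cast hN
  have hp0 : 0 ≤ p := by rw [hp]; positivity
  have hp1 : p ≤ 1 := by
    rw [hp, div_le_one hN']; exact_mod_cast hS
  have hq : 0 ≤ 1 - p := by linarith
  have hmode := aux_mode_real (Fintype.card ι) S hN hS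
  rw [← hp] at hmode
  set w : ℝ := p ^ S * (1 - p) ^ (Fintype.card ι - S) with hw
  have hw0 : 0 ≤ w := by positivity
  set E := ∑ Ω ∈ Finset.powersetCard S (Finset.univ : Finset ι), Real.exp (∑ e ∈ Ω, g e)
  have hE0 : 0 ≤ E := Finset.sum_nonneg fun _ _ => (Real.exp_pos _).le
  have h1 : E * w ≤ Real.exp (p * ∑ e, (Real.exp (g e) - 1)) := by
    calc E * w = ∑ Ω ∈ Finset.powersetCard S (Finset.univ : Finset ι),
          (∏ e ∈ Ω, (p * Real.exp (g e))) * ∏ e ∈ Finset.univ \ Ω, (1 - p) := by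
          rw [Finset.sum_mul]
          refine Finset.sum_congr rfl fun Ω hΩ => ?_
          have hc : Ω.card = S := (Finset.mem_powersetCard.1 hΩ).2
          rw [Finset.prod_mul_distrib, Finset.prod_const, Finset.prod_const,
            Finset.card_sdiff_of_subset (Finset.subset_univ _), hc, Finset.card_univ,
            Real.exp_sum, hw]
          ring
      _ ≤ ∑ Ω ∈ (Finset.univ : Finset ι).powerset,
          (∏ e ∈ Ω, (p * Real.exp (g e))) * ∏ e ∈ Finset.univ \ Ω, (1 - p) := by
          refine Finset.sum_le_sum_of_subset_of_nonneg (fun Ω h => by simp) ?_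
          intro Ω _ _
          exact mul_nonneg (Finset.prod_nonneg fun e _ => mul_nonneg hp0 (Real.exp_pos _).le)
            (Finset.prod_nonneg fun e _ => hq)
      _ = ∏ e, (p * Real.exp (g e) + (1 - p)) := by rw [Finset.prod_add]
      _ ≤ ∏ e, Real.exp (p * (Real.exp (g e) - 1)) := by
          refine Finset.prod_le_prod (fun e _ => ?_) fun e _ => ?_
          · have := Real.exp_pos (g e); positivity
          · have := Real.add_one_le_exp (p * (Real.exp (g e) - 1)); linarith
      _ = _ := by rw [← Real.exp_sum, Finset.mul_sum]
  have hcard : ((Finset.powersetCard S (Finset.univ : Finset ι)).card : ℝ) =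
      ((Fintype.card ι).choose S : ℝ) := by
    rw [Finset.card_powersetCard, Finset.card_univ]
  rw [hcard]
  calc E = E * 1 := by ring
    _ ≤ E * (((Fintype.card ι : ℝ) + 1) * (((Fintype.card ι).choose S : ℝ) * w)) :=
        mul_le_mul_of_nonneg_left hmode hE0
    _ = ((Fintype.card ι : ℝ) + 1) * ((Fintype.card ι).choose S : ℝ) * (E * w) := by ring
    _ ≤ _ := mul_le_mul_of_nonneg_left h1 (by positivity)

lemma aux_markov {ι : Type} [Fintype ι] (S : ℕ) (hN : 0 < Fintype.card ι)
    (hS : S ≤ Fintype.card ι) (p : ℝ) (hp : p = (S : ℝ) / Fintype.card ι) (g : ι → ℝ) (t : ℝ) :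
    (((Finset.powersetCard S (Finset.univ : Finset ι)).filter
      (fun Ω => t < ∑ e ∈ Ω, g e)).card : ℝ) ≤
      ((Fintype.card ι : ℝ) + 1) *
        ((Finset.powersetCard S (Finset.univ : Finset ι)).card : ℝ) *
        Real.exp (p * ∑ e, (Real.exp (g e) - 1) - t) := by
  have h := aux_mgf S hN hS p hp g
  set P := Finset.powersetCard S (Finset.univ : Finset ι)
  have h2 : ((P.filter (fun Ω => t < ∑ e ∈ Ω, g e)).card : ℝ) * Real.exp t ≤
      ∑ Ω ∈ P, Real.exp (∑ e ∈ Ω, g e) := by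
    calc _ = ∑ Ω ∈ P.filter (fun Ω => t < ∑ e ∈ Ω, g e), Real.exp t := by simp
      _ ≤ ∑ Ω ∈ P.filter (fun Ω => t < ∑ e ∈ Ω, g e), Real.exp (∑ e ∈ Ω, g e) := by
          refine Finset.sum_le_sum fun Ω hΩ => ?_
          exact Real.exp_le_exp.2 (Finset.mem_filter.1 hΩ).2.le
      _ ≤ _ := Finset.sum_le_sum_of_subset_of_nonneg (Finset.filter_subset _ _)
          fun _ _ _ => (Real.exp_pos _).le
  rw [Real.exp_sub, mul_div_assoc', le_div_iff₀ (Real.exp_pos t)]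
  exact h2.trans h

lemma aux_exp_le (u : ℝ) (hu : |u| ≤ 1) : Real.exp u - 1 ≤ u + u ^ 2 := by
  have := Real.abs_exp_sub_one_sub_id_le hu
  have := (abs_le.1 this).2
  linarith

lemma aux_bern1 {ι : Type} [Fintype ι] (S : ℕ) (hN : 0 < Fintype.card ι)
    (hS : S ≤ Fintype.card ι) (p : ℝ) (hp : p = (S : ℝ) / Fintype.card ι) (g : ι → ℝ)
    (l v t : ℝ) (hl : 0 < l) (hg : ∀ e, l * |g e| ≤ 1) (hv : ∑ e, g e ^ 2 ≤ v) :
    (((Finset.powersetCard S (Finset.univ : Finset ι)).filter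
      (fun Ω => t < ∑ e ∈ Ω, g e - p * ∑ e, g e)).card : ℝ) ≤
      ((Fintype.card ι : ℝ) + 1) *
        ((Finset.powersetCard S (Finset.univ : Finset ι)).card : ℝ) *
        Real.exp (p * l ^ 2 * v - l * t) := by
  have hp0 : 0 ≤ p := by rw [hp]; positivity
  have h := aux_markov S hN hS p hp (fun e => l * g e) (l * (t + p * ∑ e, g e))
  have e1 : (Finset.powersetCard S (Finset.univ : Finset ι)).filter
      (fun Ω => t < ∑ e ∈ Ω, g e - p * ∑ e, g e) =
      (Finset.powersetCard S (Finset.univ : Finset ι)).filter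
      (fun Ω => l * (t + p * ∑ e, g e) < ∑ e ∈ Ω, l * g e) := by
    refine Finset.filter_congr fun Ω _ => ?_
    rw [← Finset.mul_sum, mul_lt_mul_iff_right₀ hl]
    constructor <;> intro <;> linarith
  rw [e1]
  refine h.trans ?_
  refine mul_le_mul_of_nonneg_left (Real.exp_le_exp.2 ?_) (by positivity)
  have h2 : ∑ e, (Real.exp (l * g e) - 1) ≤ l * ∑ e, g e + l ^ 2 * v := by
    calc _ ≤ ∑ e, (l * g e + (l * g e) ^ 2) := by
          refine Finset.sum_le_sum fun e _ => aux_exp_le _ ?_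
          rw [abs_mul, abs_of_pos hl]; exact hg e
      _ = l * ∑ e, g e + l ^ 2 * ∑ e, g e ^ 2 := by
          rw [Finset.sum_add_distrib, Finset.mul_sum, Finset.mul_sum]
          congr 1; refine Finset.sum_congr rfl fun e _ => by ring
      _ ≤ _ := by gcongr
  have := mul_le_mul_of_nonneg_left h2 hp0
  nlinarith

lemma aux_bern {ι : Type} [Fintype ι] (S : ℕ) (hN : 0 < Fintype.card ι)
    (hS : S ≤ Fintype.card ι) (p : ℝ) (hp : p = (S : ℝ) / Fintype.card ι) (g : ι → ℝ)
    (l v t : ℝ) (hl : 0 < l) (hg : ∀ e, l * |g e| ≤ 1) (hv : ∑ e, g e ^ 2 ≤ v) :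
    (((Finset.powersetCard S (Finset.univ : Finset ι)).filter
      (fun Ω => t < |∑ e ∈ Ω, g e - p * ∑ e, g e|)).card : ℝ) ≤
      2 * (((Fintype.card ι : ℝ) + 1) *
        ((Finset.powersetCard S (Finset.univ : Finset ι)).card : ℝ) *
        Real.exp (p * l ^ 2 * v - l * t)) := by
  have h1 := aux_bern1 S hN hS p hp g l v t hl hg hv
  have h2 := aux_bern1 S hN hS p hp (fun e => - g e) l v t hl (by simpa using hg) (by simpa using hv)
  set P := Finset.powersetCard S (Finset.univ : Finset ι)
  have : P.filter (fun Ω => t < |∑ e ∈ Ω, g e - p * ∑ e, g e|) ⊆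
     P.filter (fun Ω => t < ∑ e ∈ Ω, g e - p * ∑ e, g e) ∪
     P.filter (fun Ω => t < ∑ e ∈ Ω, - g e - p * ∑ e, - g e) := by
    intro Ω hΩ
    simp only [Finset.mem_union, Finset.mem_filter] at hΩ ⊢
    rcases lt_abs.1 hΩ.2 with h | h
    · exact Or.inl ⟨hΩ.1, h⟩
    · refine Or.inr ⟨hΩ.1, ?_⟩
      simp only [Finset.sum_neg_distrib]; linarith
  have h3 := (Finset.card_le_card this).trans (Finset.card_union_le _ _)
  have h3' : ((P.filter (fun Ω => t < |∑ e ∈ Ω, g e - p * ∑ e, g e|)).card : ℝ) ≤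
    ((P.filter (fun Ω => t < ∑ e ∈ Ω, g e - p * ∑ e, g e)).card : ℝ) +
    ((P.filter (fun Ω => t < ∑ e ∈ Ω, - g e - p * ∑ e, - g e)).card : ℝ) := by exact_mod_cast h3
  linarith

/-- union bound -/
lemma aux_union {α β : Type*} (P : Finset α) (T : Finset β) (B : β → α → Prop) (c : β → ℝ)
    (h : ∀ b ∈ T, ((P.filter (B b)).card : ℝ) ≤ c b) :
    ((P.filter (fun a => ∃ b ∈ T, B b a)).card : ℝ) ≤ ∑ b ∈ T, c b := by
  have : P.filter (fun a => ∃ b ∈ T, B b a) ⊆ T.biUnion (fun b => P.filter (B b)) := by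
    intro a ha
    simp only [Finset.mem_filter, Finset.mem_biUnion] at ha ⊢
    obtain ⟨h1, b, hb, h2⟩ := ha
    exact ⟨b, hb, h1, h2⟩
  have h1 := (Finset.card_le_card this).trans Finset.card_biUnion_le
  calc ((P.filter (fun a => ∃ b ∈ T, B b a)).card : ℝ) ≤ ((∑ b ∈ T, (P.filter (B b)).card : ℕ) : ℝ) := by
        exact_mod_cast h1
    _ = ∑ b ∈ T, ((P.filter (B b)).card : ℝ) := by push_cast; rfl
    _ ≤ _ := Finset.sum_le_sum h

/-- integer grid points in a ball -/
def gridZ (a : ℕ) : Finset (Fin a → ℤ) :=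
  (Fintype.piFinset fun _ : Fin a => Finset.Icc (-(64 * a : ℤ)) (64 * a)).filter
    (fun z => ∑ i, (z i) ^ 2 ≤ 64 * a)

lemma aux_geomZ (K : ℕ) : ∑ z ∈ Finset.Icc (-(K : ℤ)) K, ((1 : ℝ) / 2) ^ z.natAbs ≤
    3 - 2 * (1 / 2) ^ K := by
  induction K with
  | zero => norm_num
  | succ K ih =>
    have : Finset.Icc (-((K + 1 : ℕ) : ℤ)) ((K + 1 : ℕ) : ℤ) =
        insert (-((K + 1 : ℕ) : ℤ)) (insert (((K + 1 : ℕ) : ℤ)) (Finset.Icc (-(K : ℤ)) K)) := by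
      ext z; simp only [Finset.mem_Icc, Finset.mem_insert]; omega
    rw [this, Finset.sum_insert, Finset.sum_insert]
    · have h1 : (-((K + 1 : ℕ) : ℤ)).natAbs = K + 1 := by omega
      have h2 : (((K + 1 : ℕ) : ℤ)).natAbs = K + 1 := by omega
      rw [h1, h2, pow_succ]
      linarith
    · simp only [Finset.mem_Icc]; omega
    · simp only [Finset.mem_Icc, Finset.mem_insert]; omega

lemma gridZ_card (a : ℕ) : ((gridZ a).card : ℝ) ≤ Real.exp (66 * a) := by
  have h1 : ∀ z ∈ gridZ a, (1 : ℝ) ≤ 2 ^ (64 * a) * ∏ i, ((1 : ℝ) / 2) ^ (z i).natAbs := by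
    intro z hz
    have hz := (Finset.mem_filter.1 hz).2
    have hs : ∑ i, (z i).natAbs ≤ 64 * a := by
      have : ((∑ i, (z i).natAbs : ℕ) : ℤ) ≤ ∑ i, (z i) ^ 2 := by
        push_cast
        refine Finset.sum_le_sum fun i _ => ?_
        rw [← sq_abs]
        have := abs_nonneg (z i)
        rcases this.eq_or_lt with h | h
        · rw [← h]; simp
        · nlinarith
      omega
    rw [Finset.prod_pow_eq_pow_sum]
    rw [one_div, inv_pow, ← div_eq_mul_inv, le_div_iff₀ (by positivity), one_mul]
    exact pow_le_pow_right₀ (by norm_num) hs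
  have h2 : ((gridZ a).card : ℝ) ≤ 2 ^ (64 * a) * 3 ^ a := by
    calc ((gridZ a).card : ℝ) = ∑ z ∈ gridZ a, (1 : ℝ) := by simp
      _ ≤ ∑ z ∈ gridZ a, 2 ^ (64 * a) * ∏ i, ((1 : ℝ) / 2) ^ (z i).natAbs := Finset.sum_le_sum h1
      _ ≤ ∑ z ∈ (Fintype.piFinset fun _ : Fin a => Finset.Icc (-(64 * a : ℤ)) (64 * a)),
          2 ^ (64 * a) * ∏ i, ((1 : ℝ) / 2) ^ (z i).natAbs := by
          refine Finset.sum_le_sum_of_subset_of_nonneg (Finset.filter_subset _ _) ?_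
          intros; positivity
      _ = 2 ^ (64 * a) * ∏ i : Fin a, ∑ z ∈ Finset.Icc (-(64 * a : ℤ)) (64 * a),
            ((1 : ℝ) / 2) ^ z.natAbs := by
          rw [← Finset.mul_sum, Finset.prod_univ_sum]
      _ ≤ 2 ^ (64 * a) * ∏ i : Fin a, (3 : ℝ) := by
          refine mul_le_mul_of_nonneg_left (Finset.prod_le_prod (fun i _ => by positivity) ?_)
            (by positivity)
          intro i _
          have := aux_geomZ (64 * a)
          have h3 : (0 : ℝ) < (1 / 2) ^ (64 * a) := by positivity
          push_cast at this
          linarith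
      _ = _ := by simp
  refine h2.trans ?_
  have he : (2 : ℝ) ≤ Real.exp 1 := by have := Real.add_one_le_exp (1 : ℝ); linarith
  calc (2 : ℝ) ^ (64 * a) * 3 ^ a ≤ 2 ^ (64 * a) * (2 ^ 2) ^ a := by gcongr; norm_num
    _ = 2 ^ (66 * a) := by rw [← pow_mul, ← pow_add]; congr 1; ring
    _ ≤ (Real.exp 1) ^ (66 * a) := by gcongr
    _ = Real.exp (66 * a) := by rw [← Real.exp_nat_mul]; simp

/-- scaled grid point -/
def gsc (a : ℕ) (z : Fin a → ℤ) : Fin a → ℝ := fun i => (z i : ℝ) / (8 * Real.sqrt a)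

lemma gsc_sq (a : ℕ) (z : Fin a → ℤ) (hz : z ∈ gridZ a) : ∑ i, gsc a z i ^ 2 ≤ 1 := by
  have hz := (Finset.mem_filter.1 hz).2
  have h : ∑ i, (z i : ℝ) ^ 2 ≤ 64 * a := by exact_mod_cast hz
  rcases Nat.eq_zero_or_pos a with h0 | h0
  · subst h0; simp
  have ha : (0 : ℝ) < a := by exact_mod_cast h0
  simp only [gsc, div_pow, mul_pow, Real.sq_sqrt ha.le]
  rw [← Finset.sum_div, div_le_one (by positivity)]
  linarith

lemma gsc_approx (a : ℕ) (x : Fin a → ℝ) (hx : ∑ i, x i ^ 2 ≤ 1) :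
    ∃ z ∈ gridZ a, ∑ i, (x i - gsc a z i) ^ 2 ≤ (1 / 8) ^ 2 := by
  rcases Nat.eq_zero_or_pos a with h0 | h0
  · subst h0; exact ⟨0, Finset.mem_filter.2 ⟨Fintype.mem_piFinset.2 (fun i => i.elim0), by simp⟩, by simp⟩
  have ha : (0 : ℝ) < a := by exact_mod_cast h0
  set s := 8 * Real.sqrt a with hs
  have hs0 : 0 < s := by positivity
  have hs2 : s ^ 2 = 64 * a := by rw [hs, mul_pow, Real.sq_sqrt ha.le]; norm_num
  have key : ∀ u : ℝ, ∃ k : ℤ, (k : ℝ) ^ 2 ≤ u ^ 2 ∧ (u - k) ^ 2 ≤ 1 := by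
    intro u
    rcases le_total 0 u with h | h
    · refine ⟨⌊u⌋, ?_, ?_⟩
      · have h1 := Int.floor_le u
        have h2 : (0 : ℝ) ≤ ⌊u⌋ := by exact_mod_cast Int.floor_nonneg.2 h
        gcongr
      · have h1 := Int.floor_le u
        have h2 := Int.lt_floor_add_one u
        nlinarith
    · refine ⟨⌈u⌉, ?_, ?_⟩
      · have h1 := Int.le_ceil u
        have h2 : (⌈u⌉ : ℝ) ≤ 0 := by exact_mod_cast Int.ceil_le.2 (by simpa using h)
        nlinarith
      · have h1 := Int.le_ceil u
        have h2 := Int.ceil_lt_add_one u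
        nlinarith
  choose f hf1 hf2 using key
  refine ⟨fun i => f (s * x i), ?_, ?_⟩
  · have hle : ∑ i, (f (s * x i)) ^ 2 ≤ 64 * (a : ℤ) := by
      have : ∑ i, (f (s * x i) : ℝ) ^ 2 ≤ 64 * a := by
        calc _ ≤ ∑ i, (s * x i) ^ 2 := Finset.sum_le_sum fun i _ => hf1 _
          _ = s ^ 2 * ∑ i, x i ^ 2 := by rw [Finset.mul_sum]; simp [mul_pow]
          _ ≤ s ^ 2 * 1 := by gcongr
          _ = _ := by rw [hs2, mul_one]
      exact_mod_cast this
    refine Finset.mem_filter.2 ⟨?_, hle⟩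
    rw [Fintype.mem_piFinset]
    intro i
    have h1 : (f (s * x i)) ^ 2 ≤ 64 * (a : ℤ) :=
      (Finset.single_le_sum (f := fun i => (f (s * x i)) ^ 2) (fun i _ => sq_nonneg _)
        (Finset.mem_univ i)).trans hle
    rw [Finset.mem_Icc]
    constructor <;> nlinarith
  · have : ∀ i, (x i - gsc a (fun i => f (s * x i)) i) ^ 2 ≤ 1 / s ^ 2 := by
      intro i
      have h := hf2 (s * x i)
      have e : x i - gsc a (fun i => f (s * x i)) i = (s * x i - f (s * x i)) / s := by
        simp only [gsc, ← hs]; field_simp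
      rw [e, div_pow]; gcongr
    calc _ ≤ ∑ i : Fin a, 1 / s ^ 2 := Finset.sum_le_sum fun i _ => this i
      _ = a * (1 / s ^ 2) := by simp
      _ ≤ _ := by rw [hs2]; field_simp; norm_num

/-- bilinear net lemma -/
lemma net_bilin (a b : ℕ) (B : Fin a → Fin b → ℝ) (c : ℝ)
    (h : ∀ z ∈ gridZ a, ∀ w ∈ gridZ b, |∑ i, ∑ j, B i j * (gsc a z i * gsc b w j)| ≤ c)
    (x : Fin a → ℝ) (y : Fin b → ℝ) :
    |∑ i, ∑ j, B i j * (x i * y j)| ≤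
      2 * c * (Real.sqrt (∑ i, x i ^ 2) * Real.sqrt (∑ j, y j ^ 2)) := by
  set T : EuclideanSpace ℝ (Fin a) → EuclideanSpace ℝ (Fin b) → ℝ :=
    fun x y => ∑ i, ∑ j, B i j * (x i * y j) with hT
  have hTc : Continuous (fun q : EuclideanSpace ℝ (Fin a) × EuclideanSpace ℝ (Fin b) =>
      |T q.1 q.2|) := by
    simp only [hT]; fun_prop
  have hcomp : IsCompact (Metric.closedBall (0 : EuclideanSpace ℝ (Fin a)) 1 ×ˢ
      Metric.closedBall (0 : EuclideanSpace ℝ (Fin b)) 1) :=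
    (isCompact_closedBall _ _).prod (isCompact_closedBall _ _)
  obtain ⟨⟨x0, y0⟩, hmem, hmax⟩ := hcomp.exists_isMaxOn ⟨(0, 0), by simp⟩ hTc.continuousOn
  set N := |T x0 y0| with hN
  have hN0 : 0 ≤ N := abs_nonneg _
  have hsmul : ∀ (s t : ℝ) x y, T (s • x) (t • y) = s * t * T x y := by
    intro s t x y
    simp only [hT, PiLp.smul_apply, smul_eq_mul, Finset.mul_sum]
    refine Finset.sum_congr rfl fun i _ => Finset.sum_congr rfl fun j _ => by ring
  have hbound : ∀ x y, |T x y| ≤ N * (‖x‖ * ‖y‖) := by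
    intro x y
    by_cases hx : x = 0
    · subst hx; simp [hT]
    by_cases hy : y = 0
    · subst hy; simp [hT]
    have hx' : 0 < ‖x‖ := norm_pos_iff.2 hx
    have hy' : 0 < ‖y‖ := norm_pos_iff.2 hy
    have h1 := hmax (a := (‖x‖⁻¹ • x, ‖y‖⁻¹ • y)) (by
      simp [norm_smul, hx'.ne', hy'.ne'])
    simp only [Set.mem_ofPred_eq, hsmul] at h1
    rw [abs_mul, abs_of_pos (by positivity)] at h1
    rw [← hN] at h1
    calc |T x y| = (‖x‖⁻¹ * ‖y‖⁻¹ * |T x y|) * (‖x‖ * ‖y‖) := by field_simp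
      _ ≤ _ := by gcongr
  have hnorm : ∀ {k : ℕ} (v : EuclideanSpace ℝ (Fin k)), ‖v‖ = Real.sqrt (∑ i, v i ^ 2) := by
    intro k v; rw [EuclideanSpace.norm_eq]; simp
  have hNle : N ≤ 2 * c := by
    have hx0 : ∑ i, x0 i ^ 2 ≤ 1 := by
      have : ‖x0‖ ≤ 1 := by simpa using hmem.1
      rw [hnorm] at this
      simpa using (Real.sqrt_le_left (by norm_num)).1 this
    have hy0 : ∑ i, y0 i ^ 2 ≤ 1 := by
      have : ‖y0‖ ≤ 1 := by simpa using hmem.2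
      rw [hnorm] at this
      simpa using (Real.sqrt_le_left (by norm_num)).1 this
    obtain ⟨z, hz, hz'⟩ := gsc_approx a x0 hx0
    obtain ⟨w, hw, hw'⟩ := gsc_approx b y0 hy0
    set x1 : EuclideanSpace ℝ (Fin a) := WithLp.toLp 2 (gsc a z)
    set y1 : EuclideanSpace ℝ (Fin b) := WithLp.toLp 2 (gsc b w)
    have d1 : ‖x0 - x1‖ ≤ 1 / 8 := by
      rw [hnorm]; exact Real.sqrt_le_iff.2 ⟨by norm_num, by simpa [x1] using hz'⟩
    have d2 : ‖y0 - y1‖ ≤ 1 / 8 := by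
      rw [hnorm]; exact Real.sqrt_le_iff.2 ⟨by norm_num, by simpa [y1] using hw'⟩
    have d3 : ‖x1‖ ≤ 1 := by
      rw [hnorm]; exact Real.sqrt_le_iff.2 ⟨by norm_num, by simpa [x1] using gsc_sq a z hz⟩
    have d4 : ‖y0‖ ≤ 1 := by simpa using hmem.2
    have hdec : T x0 y0 = T x1 y1 + T (x0 - x1) y0 + T x1 (y0 - y1) := by
      simp only [hT, ← Finset.sum_add_distrib]
      refine Finset.sum_congr rfl fun i _ => Finset.sum_congr rfl fun j _ => ?_
      simp only [PiLp.sub_apply]; ring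
    have b1 : |T x1 y1| ≤ c := h z hz w hw
    have b2 : |T (x0 - x1) y0| ≤ N * (1 / 8 * 1) := (hbound _ _).trans (by gcongr)
    have b3 : |T x1 (y0 - y1)| ≤ N * (1 * (1 / 8)) := (hbound _ _).trans (by gcongr)
    have : N ≤ c + N * (1 / 8 * 1) + N * (1 * (1 / 8)) := by
      rw [hN]
      nth_rewrite 1 [hdec]
      exact (abs_add_three _ _ _).trans (by linarith)
    have hc : 0 ≤ c := (abs_nonneg _).trans b1
    linarith
  have hf := hbound (WithLp.toLp 2 x) (WithLp.toLp 2 y)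
  rw [hnorm, hnorm] at hf
  simp only [hT] at hf
  refine hf.trans ?_
  gcongr

/-- entropy-type function -/
def hfun (m k : ℕ) : ℝ := k * (1 + Real.log m - Real.log k)

lemma geom1 (F : Finset ℕ) (c ρ B : ℝ) (hc : 0 ≤ c) (h0 : 0 < ρ) (h1 : ρ < 1) (hB : 0 ≤ B)
    (h : ∀ t ∈ F, c * ρ ^ t ≤ B) : ∑ t ∈ F, c * ρ ^ t ≤ B / (1 - ρ) := by
  have h1' : 0 < 1 - ρ := by linarith
  rcases F.eq_empty_or_nonempty with rfl | hF
  · simp; positivity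
  have hsub : F ⊆ Finset.Ico (F.min' hF) (F.max' hF + 1) := by
    intro t ht
    rw [Finset.mem_Ico]
    exact ⟨F.min'_le t ht, Nat.lt_succ_of_le (F.le_max' t ht)⟩
  calc ∑ t ∈ F, c * ρ ^ t ≤ ∑ t ∈ Finset.Ico (F.min' hF) (F.max' hF + 1), c * ρ ^ t :=
        Finset.sum_le_sum_of_subset_of_nonneg hsub (fun _ _ _ => by positivity)
    _ = c * ∑ t ∈ Finset.Ico (F.min' hF) (F.max' hF + 1), ρ ^ t := by rw [Finset.mul_sum]
    _ ≤ c * (ρ ^ (F.min' hF) / (1 - ρ)) := by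
        gcongr; exact geom_sum_Ico_le_of_lt_one h0.le h1
    _ = (c * ρ ^ (F.min' hF)) / (1 - ρ) := by ring
    _ ≤ _ := by gcongr; exact h _ (F.min'_mem hF)

lemma geom2 (F : Finset ℕ) (B : ℝ) (hB : 0 ≤ B)
    (h : ∀ t ∈ F, (4 : ℝ) ^ t ≤ B) : ∑ t ∈ F, (4 : ℝ) ^ t ≤ 4 / 3 * B := by
  rcases F.eq_empty_or_nonempty with rfl | hF
  · simp; positivity
  have hsub : F ⊆ Finset.range (F.max' hF + 1) := by
    intro t ht
    rw [Finset.mem_range]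
    exact Nat.lt_succ_of_le (F.le_max' t ht)
  calc ∑ t ∈ F, (4 : ℝ) ^ t ≤ ∑ t ∈ Finset.range (F.max' hF + 1), (4 : ℝ) ^ t :=
        Finset.sum_le_sum_of_subset_of_nonneg hsub (fun _ _ _ => by positivity)
    _ = (4 ^ (F.max' hF + 1) - 1) / (4 - 1) := by rw [geom_sum_eq (by norm_num)]
    _ ≤ 4 / 3 * 4 ^ (F.max' hF) := by rw [pow_succ]; linarith
    _ ≤ _ := by gcongr; exact h _ (F.max'_mem hF)

lemma t2lemma (u v d m k φ : ℝ) (hu : 0 < u) (hv : 0 < v) (hd : 1 ≤ d) (hm : 0 < m)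
    (hk : 0 < k) (hφ1 : 1 ≤ φ) (hφ : Real.log (u * v * m / Real.sqrt d) ≤ φ)
    (hR : v ≤ 2 * Real.sqrt d * u) (hX : 1 / 2 < u ^ 2 * m) :
    u * v * (k * (1 + Real.log m - Real.log k)) / φ ≤
      7 * Real.sqrt d * ((2 * (u ^ 2 * k) + 1 / (u ^ 2 * m)) *
        Real.sqrt (v / (u * Real.sqrt d))) := by
  have hd0 : 0 < d := by linarith
  have hsd : 0 < Real.sqrt d := Real.sqrt_pos.2 hd0
  set D := Real.sqrt d with hD
  set R := v / (u * D) with hRdef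
  set X := u ^ 2 * m with hXdef
  set a := u ^ 2 * k with hadef
  have hR0 : 0 < R := by positivity
  have hX0 : 0 < X := by positivity
  have ha0 : 0 < a := by positivity
  have hR2 : R ≤ 2 := by rw [hRdef, div_le_iff₀ (by positivity)]; nlinarith
  set y := Real.sqrt R with hy
  have hy0 : 0 < y := Real.sqrt_pos.2 hR0
  have hyy : y * y = R := Real.mul_self_sqrt hR0.le
  have hy2 : y ≤ 3 / 2 := by nlinarith
  set L := 2 + Real.log X with hL
  have hlogX : -1 ≤ Real.log X := by
    have h := Real.one_sub_inv_le_log_of_pos hX0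
    have : X⁻¹ ≤ 2 := by
      rw [inv_le_comm₀ hX0 (by norm_num)]; linarith
    linarith
  have hL1 : 1 ≤ L := by linarith
  have hρ : u * v * m / D = X * R := by
    rw [hXdef, hRdef]; field_simp
  have hlogR : Real.log R = 2 * Real.log y := by
    rw [← hyy, Real.log_mul hy0.ne' hy0.ne']; ring
  have hA : y * L ≤ 7 * φ := by
    rw [hρ, Real.log_mul hX0.ne' hR0.ne', hlogR] at hφ
    have h1 : L ≤ 2 + φ - 2 * Real.log y := by linarith
    have h2 : 1 - y⁻¹ ≤ Real.log y := Real.one_sub_inv_le_log_of_pos hy0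
    have h3 : y * (1 - y⁻¹) ≤ y * Real.log y := mul_le_mul_of_nonneg_left h2 hy0.le
    have h4 : y * (1 - y⁻¹) = y - 1 := by field_simp
    have h5 : y * L ≤ y * (2 + φ - 2 * Real.log y) := mul_le_mul_of_nonneg_left h1 hy0.le
    nlinarith
  have hB : a * (1 + Real.log m - Real.log k) ≤ L * (2 * a + 1 / X) := by
    have e1 : Real.log a = 2 * Real.log u + Real.log k := by
      rw [hadef, Real.log_mul (by positivity) hk.ne', Real.log_pow]; push_cast; ring
    have e2 : Real.log X = 2 * Real.log u + Real.log m := by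
      rw [hXdef, Real.log_mul (by positivity) hm.ne', Real.log_pow]; push_cast; ring
    have e3 : 1 + Real.log m - Real.log k = L - 1 - Real.log a := by
      rw [hL, e1, e2]; ring
    have h2 : 1 - (a * X)⁻¹ ≤ Real.log (a * X) := Real.one_sub_inv_le_log_of_pos (by positivity)
    rw [Real.log_mul ha0.ne' hX0.ne'] at h2
    have h3 : a * (1 - (a * X)⁻¹) ≤ a * (Real.log a + Real.log X) :=
      mul_le_mul_of_nonneg_left h2 ha0.le
    have h4 : a * (1 - (a * X)⁻¹) = a - 1 / X := by field_simp
    have h5 : 1 / X ≤ L * (1 / X) := le_mul_of_one_le_left (by positivity) hL1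
    rw [e3]
    have h6 : Real.log X = L - 2 := by linarith
    rw [h6] at h3
    nlinarith
  have hφ0 : 0 < φ := by linarith
  rw [div_le_iff₀ hφ0]
  calc u * v * (k * (1 + Real.log m - Real.log k))
      = D * R * (a * (1 + Real.log m - Real.log k)) := by
        rw [hRdef, hadef]; field_simp
    _ ≤ D * R * (L * (2 * a + 1 / X)) := mul_le_mul_of_nonneg_left hB (by positivity)
    _ = D * ((2 * a + 1 / X) * y) * (y * L) := by rw [← hyy]; ring
    _ ≤ D * ((2 * a + 1 / X) * y) * (7 * φ) := mul_le_mul_of_nonneg_left hA (by positivity)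
    _ = _ := by ring

lemma t2sum (G : Finset (ℕ × ℕ)) (k : ℕ → ℝ) (m d : ℝ) (hm : 0 < m) (hd : 1 ≤ d)
    (hk : ∀ s, 0 ≤ k s)
    (hG : ∀ q ∈ G, ((1 : ℝ) / 2) ^ q.2 ≤ 2 * Real.sqrt d * (1 / 2) ^ q.1 ∧
      1 / 2 < (((1 : ℝ) / 2) ^ q.1) ^ 2 * m)
    (hsum : ∀ F : Finset ℕ, ∑ s ∈ F, (((1 : ℝ) / 2) ^ s) ^ 2 * k s ≤ 4) :
    ∑ q ∈ G, (2 * ((((1 : ℝ) / 2) ^ q.1) ^ 2 * k q.1) + 1 / ((((1 : ℝ) / 2) ^ q.1) ^ 2 * m)) *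
      Real.sqrt (((1 : ℝ) / 2) ^ q.2 / ((1 / 2) ^ q.1 * Real.sqrt d)) ≤ 66 := by
  have hsd : 0 < Real.sqrt d := Real.sqrt_pos.2 (by linarith)
  set A : ℕ → ℝ := fun s =>
    2 * ((((1 : ℝ) / 2) ^ s) ^ 2 * k s) + 1 / ((((1 : ℝ) / 2) ^ s) ^ 2 * m) with hA
  have hA0 : ∀ s, 0 ≤ A s := fun s => by have := hk s; simp only [hA]; positivity
  rw [← Finset.sum_fiberwise_of_maps_to (s := G) (t := G.image Prod.fst) (g := Prod.fst)
    (fun q hq => Finset.mem_image_of_mem _ hq)]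
  have hin : ∀ s ∈ G.image Prod.fst, ∑ q ∈ G with q.1 = s, A q.1 *
      Real.sqrt (((1 : ℝ) / 2) ^ q.2 / ((1 / 2) ^ q.1 * Real.sqrt d)) ≤ A s * 6 := by
    intro s _
    have e : ∑ q ∈ G with q.1 = s, A q.1 *
      Real.sqrt (((1 : ℝ) / 2) ^ q.2 / ((1 / 2) ^ q.1 * Real.sqrt d)) =
      A s * ∑ t ∈ (G.filter (fun q => q.1 = s)).image Prod.snd,
        Real.sqrt (1 / ((1 / 2) ^ s * Real.sqrt d)) * (Real.sqrt (1 / 2)) ^ t := by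
      rw [Finset.sum_image, Finset.mul_sum]
      · refine Finset.sum_congr rfl fun q hq => ?_
        have hq := (Finset.mem_filter.1 hq).2
        rw [hq]
        congr 1
        have : Real.sqrt (1 / 2) ^ q.2 = Real.sqrt ((1 / 2) ^ q.2) := by
          rw [Real.sqrt_eq_rpow, Real.sqrt_eq_rpow, ← Real.rpow_natCast, ← Real.rpow_natCast,
            ← Real.rpow_mul (by norm_num), ← Real.rpow_mul (by norm_num), mul_comm]
        rw [this, ← Real.sqrt_mul (by positivity)]
        congr 1; ring
      · intro q hq q' hq' h
        have h1 := (Finset.mem_filter.1 (Finset.mem_coe.1 hq)).2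
        have h2 := (Finset.mem_filter.1 (Finset.mem_coe.1 hq')).2
        exact Prod.ext (h1.trans h2.symm) h
    rw [e]
    refine mul_le_mul_of_nonneg_left ?_ (hA0 s)
    have hs1 : Real.sqrt (1 / 2) ≤ 3 / 4 := Real.sqrt_le_iff.2 ⟨by norm_num, by norm_num⟩
    have hg := geom1 ((G.filter (fun q => q.1 = s)).image Prod.snd)
      (Real.sqrt (1 / ((1 / 2) ^ s * Real.sqrt d))) (Real.sqrt (1 / 2)) (3 / 2)
      (Real.sqrt_nonneg _) (Real.sqrt_pos.2 (by norm_num)) (by linarith) (by norm_num) (by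
        intro t ht
        obtain ⟨q, hq, rfl⟩ := Finset.mem_image.1 ht
        obtain ⟨hq1, rfl⟩ := Finset.mem_filter.1 hq
        have : Real.sqrt (1 / 2) ^ q.2 = Real.sqrt ((1 / 2) ^ q.2) := by
          rw [Real.sqrt_eq_rpow, Real.sqrt_eq_rpow, ← Real.rpow_natCast, ← Real.rpow_natCast,
            ← Real.rpow_mul (by norm_num), ← Real.rpow_mul (by norm_num), mul_comm]
        rw [this, ← Real.sqrt_mul (by positivity), Real.sqrt_le_iff]
        refine ⟨by norm_num, ?_⟩
        have h1 := (hG q hq1).1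
        rw [one_div_mul_eq_div, div_le_iff₀ (by positivity)]
        have : (0 : ℝ) < (1 / 2) ^ q.1 * Real.sqrt d := by positivity
        nlinarith)
    refine hg.trans ?_
    rw [div_le_iff₀ (by linarith)]
    linarith
  refine (Finset.sum_le_sum hin).trans ?_
  rw [← Finset.sum_mul]
  have h1 : ∑ s ∈ G.image Prod.fst, A s ≤ 11 := by
    simp only [hA]
    rw [Finset.sum_add_distrib, ← Finset.mul_sum]
    have h2 := hsum (G.image Prod.fst)
    have h3 : ∑ s ∈ G.image Prod.fst, 1 / ((((1 : ℝ) / 2) ^ s) ^ 2 * m) =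
        (∑ s ∈ G.image Prod.fst, (4 : ℝ) ^ s) / m := by
      rw [Finset.sum_div]
      refine Finset.sum_congr rfl fun s _ => ?_
      have : (((1 : ℝ) / 2) ^ s) ^ 2 = 1 / 4 ^ s := by
        rw [← pow_mul, mul_comm, pow_mul, show ((1:ℝ)/2)^2 = 1/4 by norm_num, _root_.one_div_pow]
      rw [this]; field_simp
    have h4 := geom2 (G.image Prod.fst) (2 * m) (by positivity) (by
      intro s hs
      obtain ⟨q, hq, rfl⟩ := Finset.mem_image.1 hs
      have h := (hG q hq).2
      have : (((1 : ℝ) / 2) ^ q.1) ^ 2 = 1 / 4 ^ q.1 := by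
        rw [← pow_mul, mul_comm, pow_mul, show ((1:ℝ)/2)^2 = 1/4 by norm_num, _root_.one_div_pow]
      rw [this] at h
      rw [one_div_mul_eq_div, lt_div_iff₀ (by positivity)] at h
      linarith)
    have h5 : (∑ s ∈ G.image Prod.fst, (4 : ℝ) ^ s) / m ≤ 3 := by
      rw [div_le_iff₀ hm]; linarith
    linarith
  linarith

lemma mid_sum (m : ℕ) (hm1 : 1 ≤ m) (p d : ℝ) (hd : 1 ≤ d) (hpd : p * m = d)
    (k l : ℕ → ℕ) (e : ℕ → ℕ → ℝ) (G : Finset (ℕ × ℕ))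
    (hkl : ∀ q ∈ G, 1 ≤ k q.1 ∧ 1 ≤ l q.2)
    (hheavy : ∀ q ∈ G, Real.sqrt d / m < (1 / 2) ^ q.1 * (1 / 2) ^ q.2)
    (hr1 : ∀ q ∈ G, ((1 : ℝ) / 2) ^ q.2 ≤ 2 * Real.sqrt d * (1 / 2) ^ q.1)
    (hr2 : ∀ q ∈ G, ((1 : ℝ) / 2) ^ q.1 ≤ 2 * Real.sqrt d * (1 / 2) ^ q.2)
    (hdisc : ∀ q ∈ G, ∀ φ : ℕ, 1 ≤ φ → φ ≤ m → φ * e q.1 q.2 ≤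
      p * Real.exp φ * (k q.1 * l q.2) + 10 * (hfun m (k q.1) + hfun m (l q.2)))
    (hk : ∀ F : Finset ℕ, ∑ s ∈ F, (((1 : ℝ) / 2) ^ s) ^ 2 * k s ≤ 4)
    (hl : ∀ F : Finset ℕ, ∑ s ∈ F, (((1 : ℝ) / 2) ^ s) ^ 2 * l s ≤ 4) :
    ∑ q ∈ G, ((1 : ℝ) / 2) ^ q.1 * (1 / 2) ^ q.2 * e q.1 q.2 ≤ 9300 * Real.sqrt d := by
  have hm : (0 : ℝ) < m := by exact_mod_cast hm1
  have hm1' : (1 : ℝ) ≤ m := by exact_mod_cast hm1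
  have hsd : 0 < Real.sqrt d := Real.sqrt_pos.2 (by linarith)
  have hsd1 : 1 ≤ Real.sqrt d := Real.one_le_sqrt.2 hd
  have hdd : Real.sqrt d * Real.sqrt d = d := Real.mul_self_sqrt (by linarith)
  have hX : ∀ u v : ℝ, 0 < u → 0 < v → Real.sqrt d / m < u * v → v ≤ 2 * Real.sqrt d * u →
      1 / 2 < u ^ 2 * m := by
    intro u v hu hv h1 h2
    rw [div_lt_iff₀ hm] at h1
    have : u * v * m ≤ u * (2 * Real.sqrt d * u) * m := by gcongr
    have h3 : Real.sqrt d * (1 / 2) < Real.sqrt d * (u ^ 2 * m) := by nlinarith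
    exact lt_of_mul_lt_mul_left h3 hsd.le
  have hterm : ∀ q ∈ G, ((1 : ℝ) / 2) ^ q.1 * (1 / 2) ^ q.2 * e q.1 q.2 ≤
      3 * Real.sqrt d * (((((1 : ℝ) / 2) ^ q.1) ^ 2 * k q.1) * ((((1 : ℝ) / 2) ^ q.2) ^ 2 * l q.2))
      + 70 * Real.sqrt d * ((2 * ((((1 : ℝ) / 2) ^ q.1) ^ 2 * k q.1) +
        1 / ((((1 : ℝ) / 2) ^ q.1) ^ 2 * m)) *
        Real.sqrt (((1 : ℝ) / 2) ^ q.2 / ((1 / 2) ^ q.1 * Real.sqrt d)))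
      + 70 * Real.sqrt d * ((2 * ((((1 : ℝ) / 2) ^ q.2) ^ 2 * l q.2) +
        1 / ((((1 : ℝ) / 2) ^ q.2) ^ 2 * m)) *
        Real.sqrt (((1 : ℝ) / 2) ^ q.1 / ((1 / 2) ^ q.2 * Real.sqrt d))) := by
    intro q hq
    have hh := hheavy q hq
    have h1 := hr1 q hq
    have h2 := hr2 q hq
    have hK : (1 : ℝ) ≤ k q.1 := by exact_mod_cast (hkl q hq).1
    have hLl : (1 : ℝ) ≤ l q.2 := by exact_mod_cast (hkl q hq).2
    have hd2 := hdisc q hq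
    set u : ℝ := (1 / 2) ^ q.1
    set v : ℝ := (1 / 2) ^ q.2
    have hu : 0 < u := by positivity
    have hv : 0 < v := by positivity
    have hu1 : u ≤ 1 := pow_le_one₀ (by norm_num) (by norm_num)
    have hv1 : v ≤ 1 := pow_le_one₀ (by norm_num) (by norm_num)
    set ρ := u * v * m / Real.sqrt d with hρ
    have hρ1 : 1 ≤ ρ := by
      rw [hρ, le_div_iff₀ hsd]; rw [div_lt_iff₀ hm] at hh; linarith
    have hρm : ρ ≤ m := by
      rw [hρ, div_le_iff₀ hsd]
      have : u * v ≤ 1 := mul_le_one₀ hu1 hv.le hv1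
      nlinarith
    have hlog0 : 0 ≤ Real.log ρ := Real.log_nonneg hρ1
    set φ : ℕ := 1 + ⌊Real.log ρ⌋₊ with hφ
    have hφ1 : 1 ≤ φ := by omega
    have hφle : (φ : ℝ) ≤ 1 + Real.log ρ := by
      rw [hφ]; push_cast; have := Nat.floor_le hlog0; linarith
    have hφge : Real.log ρ ≤ φ := by
      rw [hφ]; push_cast; have := Nat.lt_floor_add_one (Real.log ρ); linarith
    have hφm : φ ≤ m := by
      have : Real.log ρ ≤ ρ - 1 := Real.log_le_sub_one_of_pos (by linarith)
      have : (φ : ℝ) ≤ m := by linarith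
      exact_mod_cast this
    have hD := hd2 φ hφ1 hφm
    have hφ1' : (1 : ℝ) ≤ φ := by exact_mod_cast hφ1
    have hφ0 : (0 : ℝ) < φ := by linarith
    have hexp : Real.exp φ ≤ 3 * ρ := by
      calc Real.exp φ ≤ Real.exp (1 + Real.log ρ) := Real.exp_le_exp.2 hφle
        _ = Real.exp 1 * ρ := by rw [Real.exp_add, Real.exp_log (by linarith)]
        _ ≤ 3 * ρ := by have := Real.exp_one_lt_d9; gcongr; linarith
    have hT1 := t2lemma u v d m (k q.1) φ hu hv hd hm (by linarith) hφ1' hφge h1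
      (hX u v hu hv hh h1)
    have hT2 := t2lemma v u d m (l q.2) φ hv hu hd hm (by linarith) hφ1'
      (by rw [mul_comm v u]; exact hφge) h2
      (hX v u hv hu (by rw [mul_comm v u]; exact hh) h2)
    have hp0 : 0 ≤ p := by
      by_contra hneg
      push Not at hneg
      have := mul_neg_of_neg_of_pos hneg hm
      linarith
    have hE : e q.1 q.2 ≤ (p * (3 * ρ) * (k q.1 * l q.2)) +
        10 * (hfun m (k q.1) / φ) + 10 * (hfun m (l q.2) / φ) := by
      have : e q.1 q.2 ≤ (p * Real.exp φ * (k q.1 * l q.2) +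
          10 * (hfun m (k q.1) + hfun m (l q.2))) / φ := by
        rw [le_div_iff₀ hφ0]; linarith
      refine this.trans ?_
      have h3 : p * Real.exp φ * (k q.1 * l q.2) / φ ≤ p * (3 * ρ) * (k q.1 * l q.2) := by
        refine (div_le_self (by positivity) hφ1').trans ?_
        gcongr
      rw [add_div]
      have : 10 * (hfun m (k q.1) + hfun m (l q.2)) / (φ : ℝ) =
        10 * (hfun m (k q.1) / φ) + 10 * (hfun m (l q.2) / φ) := by ring
      linarith
    have h4 : u * v * (p * (3 * ρ) * (k q.1 * l q.2)) =
        3 * Real.sqrt d * ((u ^ 2 * k q.1) * (v ^ 2 * l q.2)) := by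
      rw [hρ]
      field_simp
      have : Real.sqrt d ^ 2 = p * m := by rw [Real.sq_sqrt (by linarith), hpd]
      rw [this]
      try ring
    have h5 : u * v * (hfun m (k q.1) / φ) = u * v *
      (k q.1 * (1 + Real.log m - Real.log (k q.1))) / φ := by simp only [hfun]; ring
    have h6 : u * v * (hfun m (l q.2) / φ) = v * u *
      (l q.2 * (1 + Real.log m - Real.log (l q.2))) / φ := by simp only [hfun]; ring
    have h7 := mul_le_mul_of_nonneg_left hE (mul_pos hu hv).le
    have h8 : u * v * (p * (3 * ρ) * (k q.1 * l q.2) +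
        10 * (hfun m (k q.1) / φ) + 10 * (hfun m (l q.2) / φ)) =
        u * v * (p * (3 * ρ) * (k q.1 * l q.2)) + 10 * (u * v * (hfun m (k q.1) / φ)) +
        10 * (u * v * (hfun m (l q.2) / φ)) := by ring
    rw [h8, h4, h5, h6] at h7
    linarith
  refine (Finset.sum_le_sum hterm).trans ?_
  rw [Finset.sum_add_distrib, Finset.sum_add_distrib, ← Finset.mul_sum, ← Finset.mul_sum,
    ← Finset.mul_sum]
  have s1 : ∑ q ∈ G, ((((1 : ℝ) / 2) ^ q.1) ^ 2 * k q.1) * ((((1 : ℝ) / 2) ^ q.2) ^ 2 * l q.2) ≤ 16 := by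
    calc _ ≤ ∑ q ∈ G.image Prod.fst ×ˢ G.image Prod.snd,
        ((((1 : ℝ) / 2) ^ q.1) ^ 2 * k q.1) * ((((1 : ℝ) / 2) ^ q.2) ^ 2 * l q.2) := by
          refine Finset.sum_le_sum_of_subset_of_nonneg ?_ (fun _ _ _ => by positivity)
          intro q hq
          exact Finset.mem_product.2 ⟨Finset.mem_image_of_mem _ hq, Finset.mem_image_of_mem _ hq⟩
      _ = (∑ s ∈ G.image Prod.fst, (((1 : ℝ) / 2) ^ s) ^ 2 * k s) *
          ∑ s ∈ G.image Prod.snd, (((1 : ℝ) / 2) ^ s) ^ 2 * l s := by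
          rw [Finset.sum_mul_sum, Finset.sum_product]
      _ ≤ 4 * 4 := by
          refine mul_le_mul (hk _) (hl _) (Finset.sum_nonneg fun _ _ => by positivity) (by norm_num)
      _ = 16 := by norm_num
  have s2 := t2sum G (fun s => k s) m d hm hd (fun s => by positivity) (fun q hq =>
    ⟨hr1 q hq, hX _ _ (by positivity) (by positivity) (hheavy q hq) (hr1 q hq)⟩) hk
  have s3 := t2sum (G.image Prod.swap) (fun s => l s) m d hm hd (fun s => by positivity) (fun q hq => by
    obtain ⟨q', hq', rfl⟩ := Finset.mem_image.1 hq
    exact ⟨hr2 q' hq', hX _ _ (by positivity) (by positivity)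
      (by rw [mul_comm]; exact hheavy q' hq') (hr2 q' hq')⟩) hl
  rw [Finset.sum_image (fun _ _ _ _ h => Prod.swap_injective h)] at s3
  simp only [Prod.fst_swap, Prod.snd_swap] at s3
  nlinarith

/-- dyadic level -/
def lev (x : ℝ) : ℕ :=
  if h : ∃ s : ℕ, ((1 : ℝ) / 2) ^ (s + 1) < x ∧ x ≤ (1 / 2) ^ s then h.choose else 0

lemma lev_spec (x : ℝ) (h0 : 0 < x) (h1 : x ≤ 1) :
    ((1 : ℝ) / 2) ^ (lev x + 1) < x ∧ x ≤ (1 / 2) ^ (lev x) := by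
  have h : ∃ s : ℕ, ((1 : ℝ) / 2) ^ (s + 1) < x ∧ x ≤ (1 / 2) ^ s :=
    exists_nat_pow_near_of_lt_one h0 h1 (by norm_num) (by norm_num)
  unfold lev
  rw [dif_pos h]
  exact h.choose_spec

lemma lev_sum (a : ℕ) (x : Fin a → ℝ) (hx0 : ∀ i, 0 ≤ x i) (hx : ∑ i, x i ^ 2 ≤ 1)
    (F : Finset ℕ) :
    ∑ s ∈ F, (((1 : ℝ) / 2) ^ s) ^ 2 *
      ((Finset.univ.filter (fun i => 0 < x i ∧ lev (x i) = s)).card : ℝ) ≤ 4 := by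
  have hx1 : ∀ i, x i ≤ 1 := fun i => by
    have := Finset.single_le_sum (f := fun i => x i ^ 2) (fun _ _ => sq_nonneg _) (Finset.mem_univ i)
    have := hx0 i
    nlinarith
  have h1 : ∀ s ∈ F, (((1 : ℝ) / 2) ^ s) ^ 2 *
      ((Finset.univ.filter (fun i => 0 < x i ∧ lev (x i) = s)).card : ℝ) ≤
      ∑ i ∈ Finset.univ.filter (fun i => lev (x i) = s), 4 * x i ^ 2 := by
    intro s _
    calc _ = ∑ i ∈ Finset.univ.filter (fun i => 0 < x i ∧ lev (x i) = s),
          (((1 : ℝ) / 2) ^ s) ^ 2 := by rw [Finset.sum_const, nsmul_eq_mul, mul_comm]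
      _ ≤ ∑ i ∈ Finset.univ.filter (fun i => 0 < x i ∧ lev (x i) = s), 4 * x i ^ 2 := by
          refine Finset.sum_le_sum fun i hi => ?_
          obtain ⟨h0, rfl⟩ := (Finset.mem_filter.1 hi).2
          have := (lev_spec (x i) h0 (hx1 i)).1
          rw [pow_succ] at this
          have h3 : (0 : ℝ) < (1 / 2) ^ lev (x i) := by positivity
          nlinarith
      _ ≤ _ := by
          refine Finset.sum_le_sum_of_subset_of_nonneg ?_ (fun _ _ _ => by positivity)
          intro i hi
          simp only [Finset.mem_filter] at hi ⊢
          exact ⟨hi.1, hi.2.2⟩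
  refine (Finset.sum_le_sum h1).trans ?_
  rw [← Finset.sum_biUnion]
  · calc _ ≤ ∑ i, 4 * x i ^ 2 :=
        Finset.sum_le_sum_of_subset_of_nonneg (Finset.subset_univ _) (fun _ _ _ => by positivity)
      _ = 4 * ∑ i, x i ^ 2 := by rw [Finset.mul_sum]
      _ ≤ 4 := by linarith
  · intro s _ t _ hst
    rw [Function.onFun, Finset.disjoint_left]
    intro i hi hi'
    exact hst ((Finset.mem_filter.1 hi).2.symm.trans (Finset.mem_filter.1 hi').2)

/-- deterministic regularity of the sample -/
structure GoodSet (m n : ℕ) (p d : ℝ) (Ω : Finset (Fin m × Fin n)) : Prop where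
  row : ∀ i, ((Ω.filter (fun e => e.1 = i)).card : ℝ) ≤ 3 * d
  col : ∀ j, ((Ω.filter (fun e => e.2 = j)).card : ℝ) ≤ 3 * d
  disc : ∀ (I : Finset (Fin m)) (J : Finset (Fin n)), I.Nonempty → J.Nonempty →
    ∀ φ : ℕ, 1 ≤ φ → φ ≤ m →
    φ * ((Ω.filter (fun e => e.1 ∈ I ∧ e.2 ∈ J)).card : ℝ) ≤
      p * Real.exp φ * (I.card * J.card) + 10 * (hfun m I.card + hfun m J.card)

lemma deg_sum {ι κ : Type} [Fintype κ] [DecidableEq κ] (Ω : Finset ι) (f : ι → κ) (D : ℝ)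
    (h : ∀ i, ((Ω.filter (fun e => f e = i)).card : ℝ) ≤ D) (x : κ → ℝ) (hx : ∀ i, 0 ≤ x i)  :
    ∑ e ∈ Ω, x (f e) ≤ D * ∑ i, x i := by
  rw [← Finset.sum_fiberwise_of_maps_to (s := Ω) (t := Finset.univ) (g := f)
    (fun q hq => Finset.mem_univ _), Finset.mul_sum]
  refine Finset.sum_le_sum fun i _ => ?_
  calc ∑ e ∈ Ω with f e = i, x (f e) = ∑ e ∈ Ω with f e = i, x i :=
        Finset.sum_congr rfl fun e he => by rw [(Finset.mem_filter.1 he).2]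
    _ = (Ω.filter (fun e => f e = i)).card * x i := by rw [Finset.sum_const, nsmul_eq_mul]
    _ ≤ _ := mul_le_mul_of_nonneg_right (h i) (hx i)

lemma heavy (m n : ℕ) (hm1 : 1 ≤ m) (p d : ℝ) (hd : 1 ≤ d) (hpd : p * m = d)
    (Ω : Finset (Fin m × Fin n)) (hΩ : GoodSet m n p d Ω)
    (x : Fin m → ℝ) (y : Fin n → ℝ) (hx0 : ∀ i, 0 ≤ x i) (hy0 : ∀ j, 0 ≤ y j)
    (hx : ∑ i, x i ^ 2 ≤ 1) (hy : ∑ j, y j ^ 2 ≤ 1) :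
    ∑ e ∈ Ω.filter (fun e => Real.sqrt d / m < x e.1 * y e.2), x e.1 * y e.2 ≤
      9306 * Real.sqrt d := by
  have hx1 : ∀ i, x i ≤ 1 := fun i => by
    have := Finset.single_le_sum (f := fun i => x i ^ 2) (fun _ _ => sq_nonneg _) (Finset.mem_univ i)
    have := hx0 i
    nlinarith
  have hy1 : ∀ i, y i ≤ 1 := fun i => by
    have := Finset.single_le_sum (f := fun i => y i ^ 2) (fun _ _ => sq_nonneg _) (Finset.mem_univ i)
    have := hy0 i
    nlinarith
  have hsd : 0 < Real.sqrt d := Real.sqrt_pos.2 (by linarith)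
  have hdd : Real.sqrt d * Real.sqrt d = d := Real.mul_self_sqrt (by linarith)
  have hm : (0 : ℝ) < m := by exact_mod_cast hm1
  set H := Ω.filter (fun e => Real.sqrt d / m < x e.1 * y e.2) with hH
  set H3 := H.filter (fun e => x e.1 < Real.sqrt d * y e.2 ∧ y e.2 < Real.sqrt d * x e.1) with hH3
  have hpt : ∀ e ∈ H, x e.1 * y e.2 ≤ x e.1 ^ 2 / Real.sqrt d + y e.2 ^ 2 / Real.sqrt d +
      (if x e.1 < Real.sqrt d * y e.2 ∧ y e.2 < Real.sqrt d * x e.1 then x e.1 * y e.2 else 0) := by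
    intro e _
    have a := hx0 e.1
    have b := hy0 e.2
    have c1 : 0 ≤ x e.1 ^ 2 / Real.sqrt d := by positivity
    have c2 : 0 ≤ y e.2 ^ 2 / Real.sqrt d := by positivity
    split_ifs with h
    · linarith
    · rw [not_and_or, not_lt, not_lt] at h
      rcases h with h | h
      · have : x e.1 * y e.2 ≤ x e.1 ^ 2 / Real.sqrt d := by
          rw [le_div_iff₀ hsd]; nlinarith
        linarith
      · have : x e.1 * y e.2 ≤ y e.2 ^ 2 / Real.sqrt d := by
          rw [le_div_iff₀ hsd]; nlinarith
        linarith
  refine (Finset.sum_le_sum hpt).trans ?_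
  rw [Finset.sum_add_distrib, Finset.sum_add_distrib, ← Finset.sum_filter, ← hH3]
  have hs1 : ∑ e ∈ H, x e.1 ^ 2 / Real.sqrt d ≤ 3 * Real.sqrt d := by
    rw [← Finset.sum_div, div_le_iff₀ hsd]
    have h1 : ∑ e ∈ H, x e.1 ^ 2 ≤ ∑ e ∈ Ω, x e.1 ^ 2 :=
      Finset.sum_le_sum_of_subset_of_nonneg (Finset.filter_subset _ _) (fun _ _ _ => sq_nonneg _)
    have h2 := deg_sum Ω Prod.fst (3 * d) hΩ.row (fun i => x i ^ 2) (fun i => sq_nonneg _)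
    nlinarith
  have hs2 : ∑ e ∈ H, y e.2 ^ 2 / Real.sqrt d ≤ 3 * Real.sqrt d := by
    rw [← Finset.sum_div, div_le_iff₀ hsd]
    have h1 : ∑ e ∈ H, y e.2 ^ 2 ≤ ∑ e ∈ Ω, y e.2 ^ 2 :=
      Finset.sum_le_sum_of_subset_of_nonneg (Finset.filter_subset _ _) (fun _ _ _ => sq_nonneg _)
    have h2 := deg_sum Ω Prod.snd (3 * d) hΩ.col (fun i => y i ^ 2) (fun i => sq_nonneg _)
    nlinarith
  suffices hs3 : ∑ e ∈ H3, x e.1 * y e.2 ≤ 9300 * Real.sqrt d by linarith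
  set f : Fin m × Fin n → ℕ × ℕ := fun e => (lev (x e.1), lev (y e.2)) with hf
  set I : ℕ → Finset (Fin m) := fun s => Finset.univ.filter (fun i => 0 < x i ∧ lev (x i) = s) with hI
  set J : ℕ → Finset (Fin n) := fun s => Finset.univ.filter (fun i => 0 < y i ∧ lev (y i) = s) with hJ
  have hmem : ∀ e ∈ H3, e ∈ Ω ∧ 0 < x e.1 ∧ 0 < y e.2 ∧ Real.sqrt d / m < x e.1 * y e.2 ∧
      x e.1 < Real.sqrt d * y e.2 ∧ y e.2 < Real.sqrt d * x e.1 := by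
    intro e he
    obtain ⟨he1, he2⟩ := Finset.mem_filter.1 he
    obtain ⟨he3, he4⟩ := Finset.mem_filter.1 he1
    have : 0 < x e.1 * y e.2 := lt_of_le_of_lt (by positivity) he4
    have h1 : 0 < x e.1 := lt_of_le_of_ne (hx0 _) (fun h => by rw [← h] at this; simp at this)
    have h2 : 0 < y e.2 := lt_of_le_of_ne (hy0 _) (fun h => by rw [← h] at this; simp at this)
    exact ⟨he3, h1, h2, he4, he2⟩
  have key := mid_sum m hm1 p d hd hpd (fun s => (I s).card) (fun s => (J s).card)
    (fun s t => ((Ω.filter (fun e => e.1 ∈ I s ∧ e.2 ∈ J t)).card : ℝ)) (H3.image f) ?_ ?_ ?_ ?_ ?_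
    (lev_sum m x hx0 hx) (lev_sum n y hy0 hy)
  · refine le_trans ?_ key
    rw [← Finset.sum_fiberwise_of_maps_to (s := H3) (t := H3.image f) (g := f)
      (fun q hq => Finset.mem_image_of_mem _ hq)]
    refine Finset.sum_le_sum fun q _ => ?_
    calc ∑ e ∈ H3 with f e = q, x e.1 * y e.2
        ≤ ∑ e ∈ H3 with f e = q, ((1 : ℝ) / 2) ^ q.1 * (1 / 2) ^ q.2 := by
          refine Finset.sum_le_sum fun e he => ?_
          obtain ⟨he1, rfl⟩ := Finset.mem_filter.1 he
          obtain ⟨h1, h2, h3, h4⟩ := hmem e he1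
          exact mul_le_mul (lev_spec _ h2 (hx1 _)).2 (lev_spec _ h3 (hy1 _)).2 h3.le (by positivity)
      _ = ((1 : ℝ) / 2) ^ q.1 * (1 / 2) ^ q.2 * (H3.filter (fun e => f e = q)).card := by
          rw [Finset.sum_const, nsmul_eq_mul, mul_comm]
      _ ≤ _ := by
          gcongr
          intro e he
          obtain ⟨he1, rfl⟩ := Finset.mem_filter.1 he
          obtain ⟨h1, h2, h3, h4⟩ := hmem e he1
          simp [hI, hJ, hf, h1, h2, h3]
  · intro q hq
    obtain ⟨e, he, rfl⟩ := Finset.mem_image.1 hq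
    obtain ⟨h1, h2, h3, h4⟩ := hmem e he
    exact ⟨Finset.card_pos.2 ⟨e.1, by simp [hI, hf, h2]⟩, Finset.card_pos.2 ⟨e.2, by simp [hJ, hf, h3]⟩⟩
  · intro q hq
    obtain ⟨e, he, rfl⟩ := Finset.mem_image.1 hq
    obtain ⟨h1, h2, h3, h4, h5, h6⟩ := hmem e he
    exact h4.trans_le
      (mul_le_mul (lev_spec _ h2 (hx1 _)).2 (lev_spec _ h3 (hy1 _)).2 h3.le (by positivity))
  · intro q hq
    obtain ⟨e, he, rfl⟩ := Finset.mem_image.1 hq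
    obtain ⟨h1, h2, h3, h4, h5, h6⟩ := hmem e he
    have a := (lev_spec _ h2 (hx1 _)).2
    have b := (lev_spec _ h3 (hy1 _)).1
    rw [pow_succ] at b
    simp only [hf]
    have := mul_le_mul_of_nonneg_left a hsd.le
    linarith
  · intro q hq
    obtain ⟨e, he, rfl⟩ := Finset.mem_image.1 hq
    obtain ⟨h1, h2, h3, h4, h5, h6⟩ := hmem e he
    have a := (lev_spec _ h3 (hy1 _)).2
    have b := (lev_spec _ h2 (hx1 _)).1
    rw [pow_succ] at b
    simp only [hf]
    have := mul_le_mul_of_nonneg_left a hsd.le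
    linarith
  · intro q hq
    obtain ⟨e, he, rfl⟩ := Finset.mem_image.1 hq
    obtain ⟨h1, h2, h3, h4, h5, h6⟩ := hmem e he
    exact hΩ.disc _ _ ⟨e.1, by simp [hI, hf, h2]⟩ ⟨e.2, by simp [hJ, hf, h3]⟩

lemma spec (m n : ℕ) (hm1 : 1 ≤ m) (p d KL : ℝ) (hd : 1 ≤ d) (hpd : p * m = d)
    (Ω : Finset (Fin m × Fin n)) (hΩ : GoodSet m n p d Ω)
    (hlight : ∀ z ∈ gridZ m, ∀ w ∈ gridZ n,
      |∑ e ∈ Ω, (if |gsc m z e.1 * gsc n w e.2| ≤ Real.sqrt d / m then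
          gsc m z e.1 * gsc n w e.2 else 0) -
        p * ∑ e : Fin m × Fin n, (if |gsc m z e.1 * gsc n w e.2| ≤ Real.sqrt d / m then
          gsc m z e.1 * gsc n w e.2 else 0)| ≤ KL * Real.sqrt d)
    (x : Fin m → ℝ) (y : Fin n → ℝ) :
    |∑ i, ∑ j, ((if (i, j) ∈ Ω then 1 else 0) - p) * (x i * y j)| ≤
      2 * ((KL + 9307) * Real.sqrt d) * (Real.sqrt (∑ i, x i ^ 2) * Real.sqrt (∑ j, y j ^ 2)) := by
  refine net_bilin m n _ _ ?_ x y
  intro z hz w hw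
  have hl := hlight z hz w hw
  have hx := gsc_sq m z hz
  have hy := gsc_sq n w hw
  set x := gsc m z
  set y := gsc n w
  have hsd : 0 < Real.sqrt d := Real.sqrt_pos.2 (by linarith)
  have hdd : Real.sqrt d * Real.sqrt d = d := Real.mul_self_sqrt (by linarith)
  have hm : (0 : ℝ) < m := by exact_mod_cast hm1
  have hp0 : 0 ≤ p := by
    by_contra hneg
    push Not at hneg
    have := mul_neg_of_neg_of_pos hneg hm
    linarith
  set τ := Real.sqrt d / m with hτ
  have hτ0 : 0 < τ := by positivity
  have e1 : ∑ i, ∑ j, ((if (i, j) ∈ Ω then 1 else 0) - p) * (x i * y j) =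
      ∑ e ∈ Ω, x e.1 * y e.2 - p * ∑ e : Fin m × Fin n, x e.1 * y e.2 := by
    have : ∑ i, ∑ j, ((if (i, j) ∈ Ω then (1 : ℝ) else 0) - p) * (x i * y j) =
      ∑ e : Fin m × Fin n, ((if e ∈ Ω then (1 : ℝ) else 0) - p) * (x e.1 * y e.2) := by
      rw [Fintype.sum_prod_type]
    rw [this]
    simp only [sub_mul, Finset.sum_sub_distrib, ite_mul, one_mul, zero_mul]
    rw [Finset.mul_sum, Finset.sum_ite_mem, Finset.univ_inter]
  have e2 : ∀ T : Finset (Fin m × Fin n), ∑ e ∈ T, x e.1 * y e.2 =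
      ∑ e ∈ T, (if |x e.1 * y e.2| ≤ τ then x e.1 * y e.2 else 0) +
      ∑ e ∈ T, (if τ < |x e.1 * y e.2| then x e.1 * y e.2 else 0) := by
    intro T
    rw [← Finset.sum_add_distrib]
    refine Finset.sum_congr rfl fun e _ => ?_
    by_cases h : |x e.1 * y e.2| ≤ τ
    · rw [if_pos h, if_neg (not_lt.2 h), add_zero]
    · rw [if_neg h, if_pos (not_le.1 h), zero_add]
  have h1 : |∑ e ∈ Ω, (if τ < |x e.1 * y e.2| then x e.1 * y e.2 else 0)| ≤ 9306 * Real.sqrt d := by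
    rw [← Finset.sum_filter]
    refine (Finset.abs_sum_le_sum_abs _ _).trans ?_
    have := heavy m n hm1 p d hd hpd Ω hΩ (fun i => |x i|) (fun j => |y j|) (fun _ => abs_nonneg _)
      (fun _ => abs_nonneg _) (by simpa using hx) (by simpa using hy)
    simpa [abs_mul] using this
  have h2 : |p * ∑ e : Fin m × Fin n, (if τ < |x e.1 * y e.2| then x e.1 * y e.2 else 0)| ≤
      Real.sqrt d := by
    have h3 : |∑ e : Fin m × Fin n, (if τ < |x e.1 * y e.2| then x e.1 * y e.2 else 0)| ≤ 1 / τ := by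
      refine (Finset.abs_sum_le_sum_abs _ _).trans ?_
      calc _ ≤ ∑ e : Fin m × Fin n, (x e.1 ^ 2 * y e.2 ^ 2) / τ := by
            refine Finset.sum_le_sum fun e _ => ?_
            split_ifs with h
            · rw [le_div_iff₀ hτ0, ← mul_pow, ← sq_abs (x e.1 * y e.2), sq]
              exact mul_le_mul_of_nonneg_left h.le (abs_nonneg _)
            · simp; positivity
        _ = ((∑ i, x i ^ 2) * ∑ j, y j ^ 2) / τ := by
            rw [← Finset.sum_div, Fintype.sum_prod_type, Finset.sum_mul_sum]
        _ ≤ 1 / τ := by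
            gcongr
            exact mul_le_one₀ hx (Finset.sum_nonneg fun _ _ => sq_nonneg _) hy
    rw [abs_mul, abs_of_nonneg hp0]
    calc p * _ ≤ p * (1 / τ) := mul_le_mul_of_nonneg_left h3 hp0
      _ = Real.sqrt d := by
        rw [hτ]; field_simp
        rw [sq, hdd]; exact hpd
  rw [e1, e2 Ω, e2 Finset.univ]
  have h4 := abs_le.1 h1
  have h5 := abs_le.1 h2
  have h6 := abs_le.1 hl
  rw [abs_le]
  constructor <;> linarith [h4.1, h4.2, h5.1, h5.2, h6.1, h6.2]

lemma frob_nonneg {m n : ℕ} (A : Matrix (Fin m) (Fin n) ℝ) : 0 ≤ frob A := Real.sqrt_nonneg _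

lemma frob_sq {m n : ℕ} (A : Matrix (Fin m) (Fin n) ℝ) : frob A ^ 2 = ∑ i, ∑ j, A i j ^ 2 :=
  Real.sq_sqrt (Finset.sum_nonneg fun _ _ => Finset.sum_nonneg fun _ _ => sq_nonneg _)

section
open scoped Matrix.Norms.Frobenius

lemma frob_eq_norm {m n : ℕ} (A : Matrix (Fin m) (Fin n) ℝ) : frob A = ‖A‖ := by
  rw [Matrix.frobenius_norm_def, frob, Real.sqrt_eq_rpow]
  simp

lemma frob_mul {m n k : ℕ} (A : Matrix (Fin m) (Fin n) ℝ) (B : Matrix (Fin n) (Fin k) ℝ) :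
    frob (A * B) ≤ frob A * frob B := by
  simp only [frob_eq_norm]; exact Matrix.frobenius_norm_mul A B

lemma frob_transpose {m n : ℕ} (A : Matrix (Fin m) (Fin n) ℝ) : frob Aᵀ = frob A := by
  simp only [frob_eq_norm]; exact Matrix.frobenius_norm_transpose A

lemma frob_neg {m n : ℕ} (A : Matrix (Fin m) (Fin n) ℝ) : frob (-A) = frob A := by
  simp only [frob_eq_norm]; exact norm_neg A

lemma frob_tri {m n : ℕ} (A B : Matrix (Fin m) (Fin n) ℝ) : frob A ≤ frob (A - B) + frob B := by
  simp only [frob_eq_norm]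
  calc ‖A‖ = ‖(A - B) + B‖ := by rw [sub_add_cancel]
    _ ≤ _ := norm_add_le _ _

lemma frob_zero {m n : ℕ} : frob (0 : Matrix (Fin m) (Fin n) ℝ) = 0 := by
  simp only [frob_eq_norm]; exact norm_zero

lemma frob_eq_zero {m n : ℕ} (A : Matrix (Fin m) (Fin n) ℝ) (h : frob A = 0) : A = 0 := by
  simp only [frob_eq_norm] at h; exact norm_eq_zero.1 h
end

lemma frob_trace {m n : ℕ} (A : Matrix (Fin m) (Fin n) ℝ) : frob A ^ 2 = (Aᵀ * A).trace := by
  rw [frob_sq, Matrix.trace, Finset.sum_comm]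
  refine Finset.sum_congr rfl fun j _ => ?_
  simp [Matrix.mul_apply, sq]

lemma frob_pyth {m n r : ℕ} (U : Matrix (Fin m) (Fin r) ℝ) (hU : Uᵀ * U = 1)
    (A : Matrix (Fin m) (Fin n) ℝ) :
    frob A ^ 2 = frob (Uᵀ * A) ^ 2 + frob (A - U * (Uᵀ * A)) ^ 2 := by
  have e : (A - U * (Uᵀ * A))ᵀ * (A - U * (Uᵀ * A)) = Aᵀ * A - (Uᵀ * A)ᵀ * (Uᵀ * A) := by
    simp only [transpose_sub, transpose_mul, transpose_transpose, Matrix.sub_mul, Matrix.mul_sub,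
      Matrix.mul_assoc]
    rw [← Matrix.mul_assoc Uᵀ U, hU, Matrix.one_mul]
    abel
  rw [frob_trace, frob_trace, frob_trace, e, trace_sub]; ring

lemma frob_isom {m n r : ℕ} (U : Matrix (Fin m) (Fin r) ℝ) (hU : Uᵀ * U = 1)
    (A : Matrix (Fin r) (Fin n) ℝ) : frob (U * A) = frob A := by
  have : frob (U * A) ^ 2 = frob A ^ 2 := by
    rw [frob_trace, frob_trace, transpose_mul, Matrix.mul_assoc, ← Matrix.mul_assoc Uᵀ, hU,
      Matrix.one_mul]
  exact (pow_left_inj₀ (frob_nonneg _) (frob_nonneg _) two_ne_zero).1 this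

lemma frob_contr {m n r : ℕ} (U : Matrix (Fin m) (Fin r) ℝ) (hU : Uᵀ * U = 1)
    (A : Matrix (Fin m) (Fin n) ℝ) : frob (Uᵀ * A) ≤ frob A ∧ frob (A - U * (Uᵀ * A)) ≤ frob A := by
  have := frob_pyth U hU A
  constructor
  · exact abs_le_of_sq_le_sq' (by nlinarith [sq_nonneg (frob (A - U * (Uᵀ * A)))]) (frob_nonneg _) |>.2
  · exact abs_le_of_sq_le_sq' (by nlinarith [sq_nonneg (frob (Uᵀ * A))]) (frob_nonneg _) |>.2

lemma frob_contr_right {m n r : ℕ} (V : Matrix (Fin m) (Fin r) ℝ) (hV : Vᵀ * V = 1)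
    (A : Matrix (Fin n) (Fin m) ℝ) : frob (A * V) ≤ frob A := by
  have := (frob_contr V hV Aᵀ).1
  rwa [← transpose_mul, frob_transpose, frob_transpose] at this

lemma frob_diag {r k : ℕ} (σ : Fin r → ℝ) (s : ℝ) (hs : 0 ≤ s) (h : ∀ k, s ≤ σ k)
    (R : Matrix (Fin k) (Fin r) ℝ) : s * frob R ≤ frob (R * Matrix.diagonal σ) := by
  refine abs_le_of_sq_le_sq' ?_ (frob_nonneg _) |>.2
  rw [mul_pow, frob_sq, frob_sq, Finset.mul_sum]
  refine Finset.sum_le_sum fun i _ => ?_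
  rw [Finset.mul_sum]
  refine Finset.sum_le_sum fun j _ => ?_
  rw [Matrix.mul_diagonal, mul_pow, mul_comm]
  have := h j
  gcongr

lemma G_bound {m n r : ℕ} (U : Matrix (Fin m) (Fin r) ℝ) (V : Matrix (Fin n) (Fin r) ℝ)
    (hU : Uᵀ * U = 1) (hV : Vᵀ * V = 1) (σ : Fin r → ℝ) (s : ℝ) (hs : 0 < s) (h : ∀ k, s ≤ σ k)
    (X : Matrix (Fin m) (Fin r) ℝ) (Y : Matrix (Fin n) (Fin r) ℝ)
    (hD : frob (U * Matrix.diagonal σ * Vᵀ - X * Yᵀ) ≤ s / 2) :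
    frob (X - U * (Uᵀ * X)) ≤ 2 / s * frob (U * Matrix.diagonal σ * Vᵀ - X * Yᵀ) * frob X := by
  set D := U * Matrix.diagonal σ * Vᵀ - X * Yᵀ with hDdef
  set P := Uᵀ * X with hP
  set Q := Yᵀ * V with hQ
  set T := P * Q with hT
  have hTe : T = Matrix.diagonal σ - Uᵀ * D * V := by
    rw [hT, hP, hQ, hDdef, Matrix.mul_sub, Matrix.sub_mul]
    have e1 : Uᵀ * (U * Matrix.diagonal σ * Vᵀ) * V = Matrix.diagonal σ := by
      calc _ = (Uᵀ * U) * Matrix.diagonal σ * (Vᵀ * V) := by simp only [Matrix.mul_assoc]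
        _ = _ := by rw [hU, hV, Matrix.one_mul, Matrix.mul_one]
    rw [e1]; simp only [Matrix.mul_assoc]; abel
  have hB : frob (Uᵀ * D * V) ≤ s / 2 :=
    (frob_contr_right V hV _).trans ((frob_contr U hU D).1.trans hD)
  have hlow : ∀ (k : ℕ) (R : Matrix (Fin k) (Fin r) ℝ), s / 2 * frob R ≤ frob (R * T) := by
    intro k R
    have h1 := frob_diag σ s hs.le h R
    have h2 := frob_tri (R * Matrix.diagonal σ) (R * (Uᵀ * D * V))
    rw [← Matrix.mul_sub, ← hTe] at h2
    have h3 := frob_mul R (Uᵀ * D * V)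
    have h4 := mul_le_mul_of_nonneg_left hB (frob_nonneg R)
    linarith
  have hdet : T.det ≠ 0 := by
    intro h0
    obtain ⟨v, hv, hv0⟩ := Matrix.exists_vecMul_eq_zero_iff.2 h0
    have h1 := hlow 1 (Matrix.of fun _ => v)
    have h2 : (Matrix.of fun _ : Fin 1 => v) * T = 0 := by
      ext i j
      have := congrFun hv0 j
      simpa [Matrix.mul_apply, Matrix.vecMul, dotProduct] using this
    rw [h2, frob_zero] at h1
    have h3 : frob (Matrix.of fun _ : Fin 1 => v) = 0 := by
      have := frob_nonneg (Matrix.of fun _ : Fin 1 => v)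
      nlinarith
    have h4 := frob_eq_zero _ h3
    apply hv
    ext j
    exact congrFun (congrFun h4 0) j
  have hunit : IsUnit T.det := isUnit_iff_ne_zero.2 hdet
  have h1 : P * (Q * T⁻¹) = 1 := by
    rw [← Matrix.mul_assoc]; exact Matrix.mul_nonsing_inv T hunit
  have h2 : (Q * T⁻¹) * P = 1 := mul_eq_one_comm.1 h1
  set G := X - U * (Uᵀ * X) with hG
  have hGQ : G * Q = - ((D - U * (Uᵀ * D)) * V) := by
    have : D - U * (Uᵀ * D) = - (G * Yᵀ) := by
      rw [hDdef, hG, Matrix.mul_sub, Matrix.mul_sub, Matrix.sub_mul]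
      have e1 : U * (Uᵀ * (U * Matrix.diagonal σ * Vᵀ)) = U * Matrix.diagonal σ * Vᵀ := by
        calc _ = U * ((Uᵀ * U) * Matrix.diagonal σ * Vᵀ) := by simp only [Matrix.mul_assoc]
          _ = _ := by rw [hU, Matrix.one_mul, Matrix.mul_assoc]
      rw [e1]; simp only [Matrix.mul_assoc]; abel
    rw [this, hQ, Matrix.neg_mul, neg_neg, Matrix.mul_assoc]
  have hGe : G = (G * Q * T⁻¹) * P := by
    rw [Matrix.mul_assoc G, Matrix.mul_assoc G, h2, Matrix.mul_one]
  have h3 : frob (G * Q * T⁻¹) ≤ 2 / s * frob D := by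
    have h4 := hlow m (G * Q * T⁻¹)
    rw [Matrix.nonsing_inv_mul_cancel_right _ _ hunit] at h4
    have h5 : frob (G * Q) ≤ frob D := by
      rw [hGQ, frob_neg]
      exact (frob_contr_right V hV _).trans (frob_contr U hU D).2
    rw [div_mul_eq_mul_div, le_div_iff₀ hs]
    linarith
  rw [hGe]
  refine (frob_mul _ _).trans ?_
  exact mul_le_mul h3 (frob_contr U hU X).1 (frob_nonneg _)
    (mul_nonneg (by positivity) (frob_nonneg _))

lemma row_mul {m n r : ℕ} (A : Matrix (Fin m) (Fin r) ℝ) (B : Matrix (Fin r) (Fin n) ℝ) (i : Fin m) :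
    rowNorm (A * B) i ≤ rowNorm A i * frob B := by
  have := frob_mul (Matrix.of fun _ : Fin 1 => A i) B
  have e1 : frob ((Matrix.of fun _ : Fin 1 => A i) * B) = rowNorm (A * B) i := by
    simp [frob, rowNorm, Matrix.mul_apply]
  have e2 : frob (Matrix.of fun _ : Fin 1 => A i) = rowNorm A i := by
    simp [frob, rowNorm]
  rwa [e1, e2] at this

lemma row_sub {m n : ℕ} (A B : Matrix (Fin m) (Fin n) ℝ) (i : Fin m) :
    rowNorm (A - B) i ≤ rowNorm A i + rowNorm B i := by
  have := frob_tri (Matrix.of fun _ : Fin 1 => (A - B) i) (Matrix.of fun _ : Fin 1 => (- B) i)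
  have e1 : frob (Matrix.of fun _ : Fin 1 => (A - B) i) = rowNorm (A - B) i := by
    simp [frob, rowNorm]
  have e2 : frob (Matrix.of fun _ : Fin 1 => (-B) i) = rowNorm B i := by
    simp [frob, rowNorm]
  have e3 : frob ((Matrix.of fun _ : Fin 1 => (A - B) i) - (Matrix.of fun _ : Fin 1 => (- B) i)) = rowNorm A i := by
    simp [frob, rowNorm]
  rw [e1, e2, e3] at this
  linarith

lemma sqrt_sum_mul_le {a b : ℕ} (f : Fin a → Fin b → ℝ) (g : Fin a → Fin b → ℝ) :
    ∑ k, ∑ l, Real.sqrt (f k l) * Real.sqrt (g k l) ≤ 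
      Real.sqrt (∑ k, ∑ l, |f k l|) * Real.sqrt (∑ k, ∑ l, |g k l|) := by
  have := Real.sum_mul_le_sqrt_mul_sqrt (Finset.univ : Finset (Fin a × Fin b))
    (fun q => Real.sqrt (f q.1 q.2)) (fun q => Real.sqrt (g q.1 q.2))
  rw [Fintype.sum_prod_type, Fintype.sum_prod_type, Fintype.sum_prod_type] at this
  refine this.trans ?_
  have aux : ∀ t : ℝ, Real.sqrt t ^ 2 ≤ |t| := fun t => by
    rcases le_total 0 t with h | h
    · rw [Real.sq_sqrt h]; exact le_abs_self t
    · rw [Real.sqrt_eq_zero_of_nonpos h]; simp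
  gcongr <;> apply aux

/-- cross term -/
lemma cross_bound {m n r : ℕ} (B : Fin m → Fin n → ℝ) (K su sv : ℝ) (hK : 0 ≤ K)
    (hspec : ∀ (x : Fin m → ℝ) (y : Fin n → ℝ), |∑ i, ∑ j, B i j * (x i * y j)| ≤
      K * (Real.sqrt (∑ i, x i ^ 2) * Real.sqrt (∑ j, y j ^ 2)))
    (U : Matrix (Fin m) (Fin r) ℝ) (V : Matrix (Fin n) (Fin r) ℝ)
    (hu0 : 0 ≤ su) (hv0 : 0 ≤ sv)
    (hu : ∀ i, ∑ k, U i k ^ 2 ≤ su) (hv : ∀ j, ∑ k, V j k ^ 2 ≤ sv)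
    (E : Matrix (Fin n) (Fin r) ℝ) (F : Matrix (Fin m) (Fin r) ℝ) :
    |∑ i, ∑ j, B i j * ((U * Eᵀ) i j * (F * Vᵀ) i j)| ≤
      K * (Real.sqrt su * Real.sqrt sv) * (frob E * frob F) := by
  have e : ∑ i, ∑ j, B i j * ((U * Eᵀ) i j * (F * Vᵀ) i j) =
      ∑ k, ∑ l, ∑ i, ∑ j, B i j * ((U i k * F i l) * (E j k * V j l)) := by
    have h1 : ∀ i j, B i j * ((U * Eᵀ) i j * (F * Vᵀ) i j) =
        ∑ k, ∑ l, B i j * ((U i k * F i l) * (E j k * V j l)) := by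
      intro i j
      simp only [Matrix.mul_apply, Matrix.transpose_apply]
      rw [Finset.sum_mul_sum, Finset.mul_sum]
      refine Finset.sum_congr rfl fun k _ => ?_
      rw [Finset.mul_sum]
      exact Finset.sum_congr rfl fun l _ => by ring
    simp only [h1]
    calc _ = ∑ i, ∑ k, ∑ j, ∑ l, B i j * ((U i k * F i l) * (E j k * V j l)) :=
          Finset.sum_congr rfl fun i _ => Finset.sum_comm
      _ = ∑ k, ∑ i, ∑ j, ∑ l, B i j * ((U i k * F i l) * (E j k * V j l)) := Finset.sum_comm
      _ = ∑ k, ∑ i, ∑ l, ∑ j, B i j * ((U i k * F i l) * (E j k * V j l)) :=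
          Finset.sum_congr rfl fun k _ => Finset.sum_congr rfl fun i _ => Finset.sum_comm
      _ = _ := Finset.sum_congr rfl fun k _ => Finset.sum_comm
  rw [e]
  have h2 : |∑ k, ∑ l, ∑ i, ∑ j, B i j * ((U i k * F i l) * (E j k * V j l))| ≤
      ∑ k, ∑ l, K * (Real.sqrt (∑ i, (U i k * F i l) ^ 2) * Real.sqrt (∑ j, (E j k * V j l) ^ 2)) := by
    refine (Finset.abs_sum_le_sum_abs _ _).trans (Finset.sum_le_sum fun k _ => ?_)
    refine (Finset.abs_sum_le_sum_abs _ _).trans (Finset.sum_le_sum fun l _ => ?_)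
    exact hspec _ _
  refine h2.trans ?_
  simp only [← Finset.mul_sum]
  rw [mul_assoc]
  refine mul_le_mul_of_nonneg_left ?_ hK
  refine (sqrt_sum_mul_le _ _).trans ?_
  have h3 : ∑ k, ∑ l, |∑ i, (U i k * F i l) ^ 2| ≤ su * frob F ^ 2 := by
    have : ∀ k l, |∑ i, (U i k * F i l) ^ 2| = ∑ i, U i k ^ 2 * F i l ^ 2 := fun k l => by
      rw [abs_of_nonneg (Finset.sum_nonneg fun _ _ => sq_nonneg _)]
      exact Finset.sum_congr rfl fun i _ => by rw [mul_pow]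
    simp only [this]
    calc _ = ∑ k, ∑ i, ∑ l, U i k ^ 2 * F i l ^ 2 := Finset.sum_congr rfl fun k _ => Finset.sum_comm
      _ = ∑ i, ∑ k, ∑ l, U i k ^ 2 * F i l ^ 2 := Finset.sum_comm
      _ = ∑ i, (∑ k, U i k ^ 2) * ∑ l, F i l ^ 2 :=
          Finset.sum_congr rfl fun i _ => by rw [Finset.sum_mul_sum]
      _ ≤ ∑ i, su * ∑ l, F i l ^ 2 := Finset.sum_le_sum fun i _ =>
          mul_le_mul_of_nonneg_right (hu i) (Finset.sum_nonneg fun _ _ => sq_nonneg _)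
      _ = _ := by rw [← Finset.mul_sum, frob_sq]
  have h4 : ∑ k, ∑ l, |∑ j, (E j k * V j l) ^ 2| ≤ sv * frob E ^ 2 := by
    have : ∀ k l, |∑ i, (E i k * V i l) ^ 2| = ∑ i, E i k ^ 2 * V i l ^ 2 := fun k l => by
      rw [abs_of_nonneg (Finset.sum_nonneg fun _ _ => sq_nonneg _)]
      exact Finset.sum_congr rfl fun i _ => by rw [mul_pow]
    simp only [this]
    calc _ = ∑ k, ∑ i, ∑ l, E i k ^ 2 * V i l ^ 2 := Finset.sum_congr rfl fun k _ => Finset.sum_comm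
      _ = ∑ i, ∑ k, ∑ l, E i k ^ 2 * V i l ^ 2 := Finset.sum_comm
      _ = ∑ i, (∑ k, E i k ^ 2) * ∑ l, V i l ^ 2 :=
          Finset.sum_congr rfl fun i _ => by rw [Finset.sum_mul_sum]
      _ ≤ ∑ i, (∑ k, E i k ^ 2) * sv := Finset.sum_le_sum fun i _ =>
          mul_le_mul_of_nonneg_left (hv i) (Finset.sum_nonneg fun _ _ => sq_nonneg _)
      _ = _ := by rw [← Finset.sum_mul, frob_sq, mul_comm]
  calc _ ≤ Real.sqrt (su * frob F ^ 2) * Real.sqrt (sv * frob E ^ 2) := by gcongr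
    _ = _ := by
      rw [Real.sqrt_mul hu0, Real.sqrt_mul hv0, Real.sqrt_sq (frob_nonneg _),
        Real.sqrt_sq (frob_nonneg _)]
      ring

lemma four_norm {m r : ℕ} (G : Matrix (Fin m) (Fin r) ℝ) (b : ℝ) (hb : 0 ≤ b)
    (h : ∀ i, rowNorm G i ≤ b) :
    Real.sqrt (∑ i, (∑ k, G i k ^ 2) ^ 2) ≤ b * frob G := by
  have h1 : ∀ i, ∑ k, G i k ^ 2 ≤ b ^ 2 := fun i => by
    have := h i
    rw [rowNorm, Real.sqrt_le_left hb] at this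
    exact this
  rw [Real.sqrt_le_left (mul_nonneg hb (frob_nonneg _)), mul_pow, frob_sq, Finset.mul_sum]
  refine Finset.sum_le_sum fun i _ => ?_
  rw [sq]
  exact mul_le_mul_of_nonneg_right (h1 i) (Finset.sum_nonneg fun _ _ => sq_nonneg _)

/-- small part -/
lemma small_bound {m n r : ℕ} (A : Fin m → Fin n → ℝ) (hA : ∀ i j, 0 ≤ A i j)
    (p K b1 b2 : ℝ) (hK : 0 ≤ K)
    (hspec : ∀ (x : Fin m → ℝ) (y : Fin n → ℝ), |∑ i, ∑ j, (A i j - p) * (x i * y j)| ≤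
      K * (Real.sqrt (∑ i, x i ^ 2) * Real.sqrt (∑ j, y j ^ 2)))
    (G : Matrix (Fin m) (Fin r) ℝ) (H : Matrix (Fin n) (Fin r) ℝ) (hb1 : 0 ≤ b1) (hb2 : 0 ≤ b2)
    (h1 : ∀ i, rowNorm G i ≤ b1) (h2 : ∀ j, rowNorm H j ≤ b2) :
    ∑ i, ∑ j, A i j * (G * Hᵀ) i j ^ 2 ≤ p * (frob G * frob H) ^ 2 +
      K * (b1 * b2) * (frob G * frob H) := by
  have hs := hspec (fun i => ∑ k, G i k ^ 2) (fun j => ∑ k, H j k ^ 2)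
  have hs := (abs_le.1 hs).2
  have e : ∑ i, ∑ j, (A i j - p) * ((∑ k, G i k ^ 2) * ∑ k, H j k ^ 2) =
      ∑ i, ∑ j, A i j * ((∑ k, G i k ^ 2) * ∑ k, H j k ^ 2) - p * (frob G * frob H) ^ 2 := by
    rw [mul_pow, frob_sq, frob_sq, Finset.sum_mul_sum, Finset.mul_sum, ← Finset.sum_sub_distrib]
    refine Finset.sum_congr rfl fun i _ => ?_
    rw [Finset.mul_sum, ← Finset.sum_sub_distrib]
    exact Finset.sum_congr rfl fun j _ => by ring
  rw [e] at hs
  have h3 : ∑ i, ∑ j, A i j * (G * Hᵀ) i j ^ 2 ≤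
      ∑ i, ∑ j, A i j * ((∑ k, G i k ^ 2) * ∑ k, H j k ^ 2) := by
    refine Finset.sum_le_sum fun i _ => Finset.sum_le_sum fun j _ => ?_
    refine mul_le_mul_of_nonneg_left ?_ (hA i j)
    rw [Matrix.mul_apply]
    simp only [Matrix.transpose_apply]
    exact Finset.sum_mul_sq_le_sq_mul_sq _ _ _
  have h4 := four_norm G b1 hb1 h1
  have h5 := four_norm H b2 hb2 h2
  have h6 := mul_le_mul h4 h5 (Real.sqrt_nonneg _) (mul_nonneg hb1 (frob_nonneg _))
  have h7 := mul_le_mul_of_nonneg_left h6 hK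
  have : K * (b1 * frob G * (b2 * frob H)) = K * (b1 * b2) * (frob G * frob H) := by ring
  linarith

lemma P1_sum {m n r : ℕ} (B : Fin m → Fin n → ℝ) (c : ℝ) (U : Matrix (Fin m) (Fin r) ℝ)
    (h : ∀ (j : Fin n) (w : Fin r → ℝ), |∑ i, B i j * (∑ k, U i k * w k) ^ 2| ≤ c * ∑ k, w k ^ 2)
    (E : Matrix (Fin n) (Fin r) ℝ) :
    |∑ i, ∑ j, B i j * (U * Eᵀ) i j ^ 2| ≤ c * frob E ^ 2 := by
  rw [Finset.sum_comm, frob_sq, Finset.mul_sum]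
  refine (Finset.abs_sum_le_sum_abs _ _).trans (Finset.sum_le_sum fun j _ => ?_)
  have := h j (E j)
  simpa [Matrix.mul_apply] using this

lemma sq_up (c b : ℝ) : (c - b) ^ 2 ≤ 5 / 4 * c ^ 2 + 5 * b ^ 2 := by
  nlinarith [sq_nonneg (c + 4 * b)]

lemma sq_lo (c b : ℝ) : 3 / 4 * c ^ 2 + (-3) * b ^ 2 ≤ (c - b) ^ 2 := by
  nlinarith [sq_nonneg (c - 4 * b)]

set_option maxHeartbeats 1000000 in
lemma det_main {m n r : ℕ} (A : Fin m → Fin n → ℝ) (hA : ∀ i j, 0 ≤ A i j)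
    (p K su sv s L κ : ℝ) (hp : 0 ≤ p) (hK : 0 ≤ K) (hr : 1 ≤ r) (hs0 : 0 < s) (hκ : κ = L / s)
    (hκ1 : 1 ≤ κ) (hu0 : 0 ≤ su) (hv0 : 0 ≤ sv)
    (U : Matrix (Fin m) (Fin r) ℝ) (V : Matrix (Fin n) (Fin r) ℝ)
    (hU : Uᵀ * U = 1) (hV : Vᵀ * V = 1) (σ : Fin r → ℝ) (hσ : ∀ k, s ≤ σ k)
    (hu : ∀ i, ∑ k, U i k ^ 2 ≤ su) (hv : ∀ j, ∑ k, V j k ^ 2 ≤ sv)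
    (hspec : ∀ (x : Fin m → ℝ) (y : Fin n → ℝ), |∑ i, ∑ j, (A i j - p) * (x i * y j)| ≤
      K * (Real.sqrt (∑ i, x i ^ 2) * Real.sqrt (∑ j, y j ^ 2)))
    (hcol : ∀ (j : Fin n) (w : Fin r → ℝ), |∑ i, (A i j - p) * (∑ k, U i k * w k) ^ 2| ≤
      p / 20 * ∑ k, w k ^ 2)
    (hrow : ∀ (i : Fin m) (w : Fin r → ℝ), |∑ j, (A i j - p) * (∑ k, V j k * w k) ^ 2| ≤
      p / 20 * ∑ k, w k ^ 2)
    (hKs : 1920 * r ^ 2 * κ ^ 2 * (K * (Real.sqrt su * Real.sqrt sv)) ≤ p)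
    (X : Matrix (Fin m) (Fin r) ℝ) (Y : Matrix (Fin n) (Fin r) ℝ)
    (hX : frob X ≤ Real.sqrt (r * L)) (hY : frob Y ≤ Real.sqrt (r * L))
    (hX1 : ∀ i, rowNorm X i ≤ Real.sqrt (r * L) * Real.sqrt (3 * su))
    (hY1 : ∀ i, rowNorm Y i ≤ Real.sqrt (r * L) * Real.sqrt (3 * sv))
    (hD : frob (U * Matrix.diagonal σ * Vᵀ - X * Yᵀ) ≤ s / (100 * r * κ)) :
    1 / 3 * p * frob (U * Matrix.diagonal σ * Vᵀ - X * Yᵀ) ^ 2 ≤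
      ∑ i, ∑ j, A i j * (U * Matrix.diagonal σ * Vᵀ - X * Yᵀ) i j ^ 2 ∧
    ∑ i, ∑ j, A i j * (U * Matrix.diagonal σ * Vᵀ - X * Yᵀ) i j ^ 2 ≤
      2 * p * frob (U * Matrix.diagonal σ * Vᵀ - X * Yᵀ) ^ 2 := by
  have hr1 : (1 : ℝ) ≤ r := by exact_mod_cast hr
  have hL0 : 0 < L := by
    have : L = κ * s := by rw [hκ]; field_simp
    rw [this]; positivity
  have hDs : frob (U * Matrix.diagonal σ * Vᵀ - X * Yᵀ) ≤ s / 2 := by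
    refine hD.trans (div_le_div_of_nonneg_left hs0.le (by norm_num) ?_)
    have := one_le_mul_of_one_le_of_one_le hr1 hκ1
    linarith
  have hG := G_bound U V hU hV σ s hs0 hσ X Y hDs
  have htr : (U * Matrix.diagonal σ * Vᵀ - X * Yᵀ)ᵀ = V * Matrix.diagonal σ * Uᵀ - Y * Xᵀ := by
    simp [transpose_sub, transpose_mul, Matrix.mul_assoc]
  have hH := G_bound V U hV hU σ s hs0 hσ Y X (by rw [← htr, frob_transpose]; exact hDs)
  rw [← htr, frob_transpose] at hH
  have hUdef : U * (Uᵀ * (U * Matrix.diagonal σ * Vᵀ)) = U * Matrix.diagonal σ * Vᵀ := by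
    calc _ = U * ((Uᵀ * U) * Matrix.diagonal σ * Vᵀ) := by simp only [Matrix.mul_assoc]
      _ = _ := by rw [hU, Matrix.one_mul, Matrix.mul_assoc]
  set M := U * Matrix.diagonal σ * Vᵀ with hM
  set D := M - X * Yᵀ with hDdef
  set G := X - U * (Uᵀ * X) with hGdef
  set H := Y - V * (Vᵀ * Y) with hHdef
  set E : Matrix (Fin n) (Fin r) ℝ := (Uᵀ * D)ᵀ with hE
  set D' := D - U * (Uᵀ * D) with hD'
  set F := D' * V with hF
  set a1 := U * Eᵀ with ha1
  set a2 := F * Vᵀ with ha2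
  have hD'G : D' = - (G * Yᵀ) := by
    rw [hD', hDdef, hGdef, Matrix.mul_sub, Matrix.mul_sub, Matrix.sub_mul, hUdef]
    simp only [Matrix.mul_assoc]; abel
  have hb : D' - a2 = - (G * Hᵀ) := by
    rw [ha2, hF, hD'G, hHdef]
    simp only [transpose_sub, transpose_mul, transpose_transpose, Matrix.mul_sub, Matrix.neg_mul,
      Matrix.mul_assoc]
    abel
  have hsplit : D = a1 + a2 - G * Hᵀ := by
    have : D = a1 + D' := by rw [hD', ha1, hE, transpose_transpose]; abel
    have h2 : D' = a2 - G * Hᵀ := by rw [sub_eq_add_neg, ← hb]; abel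
    rw [this, h2]; abel
  have hpy1 : frob D ^ 2 = frob E ^ 2 + frob D' ^ 2 := by
    rw [hE, frob_transpose]; exact frob_pyth U hU D
  have hpy2 : frob D' ^ 2 = frob F ^ 2 + frob (G * Hᵀ) ^ 2 := by
    have := frob_pyth V hV D'ᵀ
    have e1 : Vᵀ * D'ᵀ = Fᵀ := by rw [hF, transpose_mul]
    have e2 : D'ᵀ - V * Fᵀ = (- (G * Hᵀ))ᵀ := by
      rw [← hb, transpose_sub D' a2, ha2, transpose_mul F, transpose_transpose]
    rw [e1, e2, frob_transpose, frob_transpose, frob_transpose, frob_neg] at this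
    exact this
  have horth : ∑ i, ∑ j, a1 i j * a2 i j = 0 := by
    have e1 : ∑ i, ∑ j, a1 i j * a2 i j = (a1ᵀ * a2).trace := by
      rw [Matrix.trace, Finset.sum_comm]
      refine Finset.sum_congr rfl fun j _ => ?_
      simp [Matrix.mul_apply]
    have e2 : Uᵀ * D' = 0 := by
      rw [hD', Matrix.mul_sub, ← Matrix.mul_assoc Uᵀ U, hU, Matrix.one_mul, sub_self]
    have e3 : a1ᵀ * a2 = 0 := by
      rw [ha1, ha2, hF, transpose_mul]
      calc _ = Eᵀᵀ * ((Uᵀ * D') * V * Vᵀ) := by simp only [Matrix.mul_assoc]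
        _ = 0 := by rw [e2]; simp
    rw [e1, e3]; simp
  clear_value a1 a2 F D' E H G D M
  have hGH : frob G * frob H ≤ 4 * r * κ / s * frob D ^ 2 := by
    have hsq : Real.sqrt (r * L) * Real.sqrt (r * L) = r * L := Real.mul_self_sqrt (by positivity)
    have g1 : frob G ≤ 2 / s * frob D * Real.sqrt (r * L) :=
      hG.trans (mul_le_mul_of_nonneg_left hX (mul_nonneg (by positivity) (frob_nonneg _)))
    have g2 : frob H ≤ 2 / s * frob D * Real.sqrt (r * L) :=
      hH.trans (mul_le_mul_of_nonneg_left hY (mul_nonneg (by positivity) (frob_nonneg _)))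
    refine (mul_le_mul g1 g2 (frob_nonneg _)
      (mul_nonneg (mul_nonneg (by positivity) (frob_nonneg _)) (Real.sqrt_nonneg _))).trans ?_
    have : 2 / s * frob D * Real.sqrt (r * L) * (2 / s * frob D * Real.sqrt (r * L)) =
      (2 / s) ^ 2 * frob D ^ 2 * (Real.sqrt (r * L) * Real.sqrt (r * L)) := by ring
    rw [this, hsq, hκ]
    refine le_of_eq ?_
    field_simp
    try ring
  have hGH2 : frob G * frob H ≤ 1 / 25 * frob D := by
    refine hGH.trans ?_
    have h1 : frob D ^ 2 ≤ s / (100 * r * κ) * frob D := by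
      rw [sq]; exact mul_le_mul_of_nonneg_right hD (frob_nonneg _)
    calc 4 * r * κ / s * frob D ^ 2 ≤ 4 * r * κ / s * (s / (100 * r * κ) * frob D) :=
          mul_le_mul_of_nonneg_left h1 (by positivity)
      _ = _ := by field_simp; ring
  have hGH0 : 0 ≤ frob G * frob H := mul_nonneg (frob_nonneg _) (frob_nonneg _)
  have hGHsq : (frob G * frob H) ^ 2 ≤ (1 / 625) * frob D ^ 2 := by
    calc _ ≤ (1 / 25 * frob D) ^ 2 := pow_le_pow_left₀ hGH0 hGH2 2
      _ = _ := by ring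
  have hbn : frob (G * Hᵀ) ^ 2 ≤ (1 / 625) * frob D ^ 2 := by
    refine le_trans (pow_le_pow_left₀ (frob_nonneg _) (frob_mul _ _) 2) ?_
    rw [frob_transpose]; exact hGHsq
  have rowb : ∀ {a : ℕ} (W Z : Matrix (Fin a) (Fin r) ℝ) (t : ℝ) (_ : 0 ≤ t) (_ : Wᵀ * W = 1)
      (_ : ∀ i, ∑ k, W i k ^ 2 ≤ t) (_ : frob Z ≤ Real.sqrt (r * L))
      (_ : ∀ i, rowNorm Z i ≤ Real.sqrt (r * L) * Real.sqrt (3 * t)) (i : Fin a),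
      rowNorm (Z - W * (Wᵀ * Z)) i ≤ 2 * (Real.sqrt (r * L) * Real.sqrt (3 * t)) := by
    intro a W Z t ht hW hWt hZ hZ1 i
    refine (row_sub _ _ i).trans ?_
    have h1 := row_mul W (Wᵀ * Z) i
    have h2 : rowNorm W i ≤ Real.sqrt (3 * t) :=
      Real.sqrt_le_sqrt ((hWt i).trans (by linarith))
    have h3 := (frob_contr W hW Z).1.trans hZ
    have h4 := mul_le_mul h2 h3 (frob_nonneg _) (Real.sqrt_nonneg _)
    linarith [hZ1 i]
  set b1 := 2 * (Real.sqrt (r * L) * Real.sqrt (3 * su)) with hb1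
  set b2 := 2 * (Real.sqrt (r * L) * Real.sqrt (3 * sv)) with hb2
  have hsm := small_bound A hA p K b1 b2 hK hspec G H (by positivity) (by positivity)
    (by rw [hGdef]; exact rowb U X su hu0 hU hu hX hX1)
    (by rw [hHdef]; exact rowb V Y sv hv0 hV hv hY hY1)
  have hb12 : b1 * b2 = 12 * (r * L) * (Real.sqrt su * Real.sqrt sv) := by
    have hsq : Real.sqrt (r * L) * Real.sqrt (r * L) = r * L := Real.mul_self_sqrt (by positivity)
    have h3 : Real.sqrt 3 * Real.sqrt 3 = 3 := Real.mul_self_sqrt (by norm_num)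
    rw [hb1, hb2, Real.sqrt_mul (by norm_num) su, Real.sqrt_mul (by norm_num) sv]
    calc _ = 4 * (Real.sqrt (r * L) * Real.sqrt (r * L)) * (Real.sqrt 3 * Real.sqrt 3) *
        (Real.sqrt su * Real.sqrt sv) := by ring
      _ = _ := by rw [hsq, h3]; ring
  have hqb : ∑ i, ∑ j, A i j * (G * Hᵀ) i j ^ 2 ≤ 1 / 20 * p * frob D ^ 2 := by
    refine hsm.trans ?_
    have h1 : p * (frob G * frob H) ^ 2 ≤ p * ((1 / 625) * frob D ^ 2) :=
      mul_le_mul_of_nonneg_left hGHsq hp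
    have h2 : K * (b1 * b2) * (frob G * frob H) ≤ p / 40 * frob D ^ 2 := by
      rw [hb12]
      calc K * (12 * (r * L) * (Real.sqrt su * Real.sqrt sv)) * (frob G * frob H)
          ≤ K * (12 * (r * L) * (Real.sqrt su * Real.sqrt sv)) * (4 * r * κ / s * frob D ^ 2) :=
            mul_le_mul_of_nonneg_left hGH (by positivity)
        _ = (1920 * r ^ 2 * κ ^ 2 * (K * (Real.sqrt su * Real.sqrt sv))) / 40 * frob D ^ 2 := by
            rw [hκ]; field_simp; ring
        _ ≤ _ := by gcongr
    have h3 : 0 ≤ p * frob D ^ 2 := by positivity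
    linarith
  have hc := cross_bound (fun i j => A i j - p) K su sv hK hspec U V hu0 hv0 hu hv E F
  rw [← ha1, ← ha2] at hc
  have hcr : |∑ i, ∑ j, A i j * (a1 i j * a2 i j)| ≤ p / 40 * (frob E ^ 2 + frob F ^ 2) := by
    have e1 : ∑ i, ∑ j, (A i j - p) * (a1 i j * a2 i j) = ∑ i, ∑ j, A i j * (a1 i j * a2 i j) := by
      have : ∑ i, ∑ j, (A i j - p) * (a1 i j * a2 i j) = ∑ i, ∑ j, A i j * (a1 i j * a2 i j) -
        p * ∑ i, ∑ j, a1 i j * a2 i j := by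
        rw [Finset.mul_sum, ← Finset.sum_sub_distrib]
        refine Finset.sum_congr rfl fun i _ => ?_
        rw [Finset.mul_sum, ← Finset.sum_sub_distrib]
        exact Finset.sum_congr rfl fun j _ => by ring
      rw [this, horth, mul_zero, sub_zero]
    rw [← e1]
    refine hc.trans ?_
    have h1 : K * (Real.sqrt su * Real.sqrt sv) ≤ p / 20 := by
      have h0 : 0 ≤ K * (Real.sqrt su * Real.sqrt sv) := by positivity
      have h2 : (1 : ℝ) ≤ r ^ 2 * κ ^ 2 := by
        rw [← mul_pow]; exact one_le_pow₀ (one_le_mul_of_one_le_of_one_le hr1 hκ1)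
      have h5 := mul_le_mul_of_nonneg_right h2 h0
      have h6 : 1920 * (r : ℝ) ^ 2 * κ ^ 2 * (K * (Real.sqrt su * Real.sqrt sv)) =
        1920 * ((r : ℝ) ^ 2 * κ ^ 2 * (K * (Real.sqrt su * Real.sqrt sv))) := by ring
      rw [h6] at hKs
      linarith
    have h3 : frob E * frob F ≤ (frob E ^ 2 + frob F ^ 2) / 2 := by
      nlinarith [sq_nonneg (frob E - frob F)]
    have h4 := mul_le_mul h1 h3 (mul_nonneg (frob_nonneg _) (frob_nonneg _)) (by positivity)
    linarith
  have expand : ∀ Z : Matrix (Fin m) (Fin n) ℝ, ∑ i, ∑ j, (A i j - p) * Z i j ^ 2 =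
      ∑ i, ∑ j, A i j * Z i j ^ 2 - p * frob Z ^ 2 := by
    intro Z
    rw [frob_sq, Finset.mul_sum, ← Finset.sum_sub_distrib]
    refine Finset.sum_congr rfl fun i _ => ?_
    rw [Finset.mul_sum, ← Finset.sum_sub_distrib]
    exact Finset.sum_congr rfl fun j _ => by ring
  have hq1 := P1_sum (fun i j => A i j - p) (p / 20) U hcol E
  have hq2 := P1_sum (fun j i => A i j - p) (p / 20) V hrow F
  rw [Finset.sum_comm] at hq2
  have e2 : ∑ j, ∑ i, (A j i - p) * (V * Fᵀ) i j ^ 2 = ∑ i, ∑ j, (A i j - p) * a2 i j ^ 2 := by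
    have : V * Fᵀ = a2ᵀ := by rw [ha2, transpose_mul F, transpose_transpose]
    simp only [this, Matrix.transpose_apply]
  rw [e2, expand] at hq2
  rw [← ha1, expand] at hq1
  have f1 : frob a1 = frob E := by rw [ha1, frob_isom U hU, frob_transpose]
  have f2 : frob a2 = frob F := by
    rw [ha2, ← frob_transpose, transpose_mul, transpose_transpose, frob_isom V hV, frob_transpose]
  rw [f1] at hq1
  rw [f2] at hq2
  have hq1 := abs_le.1 hq1
  have hq2 := abs_le.1 hq2
  have hcr := abs_le.1 hcr
  set q1 := ∑ i, ∑ j, A i j * a1 i j ^ 2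
  set q2 := ∑ i, ∑ j, A i j * a2 i j ^ 2
  set qc := ∑ i, ∑ j, A i j * (a1 i j * a2 i j)
  set qb := ∑ i, ∑ j, A i j * (G * Hᵀ) i j ^ 2
  have hcomb : ∀ α β : ℝ, α * (q1 + q2 + 2 * qc) + β * qb = ∑ i, ∑ j, A i j *
      (α * (a1 i j + a2 i j) ^ 2 + β * (G * Hᵀ) i j ^ 2) := by
    intro α β
    simp only [q1, q2, qc, qb, Finset.mul_sum, ← Finset.sum_add_distrib]
    refine Finset.sum_congr rfl fun i _ => Finset.sum_congr rfl fun j _ => by ring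
  have hup : ∑ i, ∑ j, A i j * D i j ^ 2 ≤ 5 / 4 * (q1 + q2 + 2 * qc) + 5 * qb := by
    rw [hcomb]
    refine Finset.sum_le_sum fun i _ => Finset.sum_le_sum fun j _ =>
      mul_le_mul_of_nonneg_left ?_ (hA i j)
    rw [hsplit, Matrix.sub_apply, Matrix.add_apply]
    exact sq_up _ _
  have hlo : 3 / 4 * (q1 + q2 + 2 * qc) + (-3) * qb ≤ ∑ i, ∑ j, A i j * D i j ^ 2 := by
    rw [hcomb]
    refine Finset.sum_le_sum fun i _ => Finset.sum_le_sum fun j _ =>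
      mul_le_mul_of_nonneg_left ?_ (hA i j)
    rw [hsplit, Matrix.sub_apply, Matrix.add_apply]
    exact sq_lo _ _
  have k1 : p * frob D ^ 2 = p * frob E ^ 2 + p * frob F ^ 2 + p * frob (G * Hᵀ) ^ 2 := by
    rw [hpy1, hpy2]; ring
  have k2 := mul_le_mul_of_nonneg_left hbn hp
  have k3 : 0 ≤ p * frob (G * Hᵀ) ^ 2 := by positivity
  have k4 : 0 ≤ p * frob E ^ 2 := by positivity
  have k5 : 0 ≤ p * frob F ^ 2 := by positivity
  constructor
  · linarith [hq1.1, hq2.1, hcr.1]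
  · linarith [hq1.2, hq2.2, hcr.2]

lemma ev_gen {α β : Type*} (m n : ℕ) (hm : 12 ≤ m) (hn : 1 ≤ n) (hnm : n ≤ m)
    (P : Finset α) (T : Finset β) (B : β → α → Prop) (a b : ℝ)
    (hT : (T.card : ℝ) ≤ Real.exp a)
    (h : ∀ x ∈ T, ((P.filter (B x)).card : ℝ) ≤
      2 * (((m : ℝ) * n + 1) * (P.card : ℝ) * Real.exp b))
    (hab : a + b ≤ - (9 * Real.log m)) :
    ((P.filter (fun y => ∃ x ∈ T, B x y)).card : ℝ) ≤ P.card * Real.exp (- (5 * Real.log m)) := by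
  have hm0 : (0 : ℝ) < m := by positivity
  have hm12 : (12 : ℝ) ≤ m := by exact_mod_cast hm
  have hnm' : (n : ℝ) ≤ m := by exact_mod_cast hnm
  have hn0 : (1 : ℝ) ≤ n := by exact_mod_cast hn
  refine (aux_union P T B _ h).trans ?_
  rw [Finset.sum_const, nsmul_eq_mul]
  have e1 : Real.exp (4 * Real.log m) = (m : ℝ) ^ 4 := by
    rw [mul_comm, Real.exp_mul, Real.exp_log hm0]; norm_cast
  have h2 : 2 * ((m : ℝ) * n + 1) ≤ Real.exp (4 * Real.log m) := by
    rw [e1]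
    have : (m : ℝ) * n ≤ m * m := by gcongr
    nlinarith [sq_nonneg ((m : ℝ)), sq_nonneg ((m : ℝ) ^ 2 - 2)]
  calc (T.card : ℝ) * (2 * (((m : ℝ) * n + 1) * (P.card : ℝ) * Real.exp b))
      = P.card * (T.card * (2 * ((m : ℝ) * n + 1)) * Real.exp b) := by ring
    _ ≤ P.card * (Real.exp a * Real.exp (4 * Real.log m) * Real.exp b) := by gcongr
    _ = P.card * Real.exp (a + 4 * Real.log m + b) := by rw [Real.exp_add, Real.exp_add]
    _ ≤ _ := by gcongr; linarith

lemma line_sum {ι : Type} [Fintype ι] {q : ℕ} (f : Fin q → ι) (hf : Function.Injective f)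
    (c : Fin q → ℝ) :
    ∃ g : ι → ℝ, (∀ Ω : Finset ι, ∑ e ∈ Ω, g e = ∑ x, (if f x ∈ Ω then 1 else 0) * c x) ∧
      (∀ B, 0 ≤ B → (∀ x, |c x| ≤ B) → ∀ e, |g e| ≤ B) ∧ ∑ e, g e ^ 2 = ∑ x, c x ^ 2 := by
  have key : ∀ (c : Fin q → ℝ) (Ω : Finset ι), ∑ e ∈ Ω, Function.extend f c 0 e =
      ∑ x, (if f x ∈ Ω then 1 else 0) * c x := by
    intro c Ω
    have h1 : ∑ x, (if f x ∈ Ω then 1 else 0) * c x =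
        ∑ x, (if f x ∈ Ω then Function.extend f c 0 (f x) else 0) := by
      refine Finset.sum_congr rfl fun x _ => ?_
      rw [hf.extend_apply]; split_ifs <;> simp
    rw [h1, ← Finset.sum_filter]
    have h2 : ∑ x with f x ∈ Ω, Function.extend f c 0 (f x) =
        ∑ e ∈ (Finset.univ.filter (fun x => f x ∈ Ω)).image f, Function.extend f c 0 e := by
      rw [Finset.sum_image]; exact fun x _ y _ h => hf h
    rw [h2]
    symm
    refine Finset.sum_subset ?_ ?_
    · intro e he
      simp only [Finset.mem_image, Finset.mem_filter] at he
      obtain ⟨x, hx, rfl⟩ := he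
      exact hx.2
    · intro e he hn
      rw [Function.extend_apply']
      · rfl
      · rintro ⟨x, rfl⟩
        exact hn (Finset.mem_image_of_mem _ (by simpa using he))
  refine ⟨Function.extend f c 0, key c, ?_, ?_⟩
  · intro B hB h e
    by_cases he : ∃ x, f x = e
    · obtain ⟨x, rfl⟩ := he; rw [hf.extend_apply]; exact h x
    · rw [Function.extend_apply' _ _ _ he]; simpa using hB
  · have := key (fun x => c x ^ 2) Finset.univ
    simp only [Finset.mem_univ, if_true, one_mul] at this
    rw [← this]
    refine Finset.sum_congr rfl fun e _ => ?_
    by_cases he : ∃ x, f x = e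
    · obtain ⟨x, rfl⟩ := he; rw [hf.extend_apply, hf.extend_apply]
    · rw [Function.extend_apply' _ _ _ he, Function.extend_apply' _ _ _ he]; simp

lemma ev_row {β : Type} [Fintype β] (m n S : ℕ) (hm : 12 ≤ m) (hn : 1 ≤ n) (hnm : n ≤ m)
    (hS : S ≤ m * n) (p : ℝ) (hp : p = (S : ℝ) / (m * n)) (q : ℕ) (hq : q ≤ m)
    (hβ : Fintype.card β ≤ m) (hd : 10 * Real.log m ≤ p * m)
    (emb : β → Fin q → Fin m × Fin n) (hemb : ∀ b, Function.Injective (emb b)) :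
    (((Finset.powersetCard S (Finset.univ : Finset (Fin m × Fin n))).filter
      (fun Ω => ∃ b ∈ (Finset.univ : Finset β),
        3 * (p * m) < ∑ x, (if emb b x ∈ Ω then (1 : ℝ) else 0))).card : ℝ) ≤
      ((Finset.powersetCard S (Finset.univ : Finset (Fin m × Fin n))).card : ℝ) *
        Real.exp (- (5 * Real.log m)) := by
  have hm0 : (0 : ℝ) < m := by positivity
  have hp0 : 0 ≤ p := by rw [hp]; positivity
  have hc : Fintype.card (Fin m × Fin n) = m * n := by simp
  refine ev_gen m n hm hn hnm _ _ _ (Real.log m) (- (p * m)) ?_ ?_ (by linarith)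
  · rw [Real.exp_log hm0]; exact_mod_cast hβ
  intro b _
  obtain ⟨g, h1, h2, h3⟩ := line_sum (emb b) (hemb b) (fun _ => 1)
  have hqm : (q : ℝ) ≤ m := by exact_mod_cast hq
  have := aux_bern S (by rw [hc]; positivity) (by rw [hc]; exact hS) p
    (by rw [hc, hp]; push_cast; ring) g 1 m (2 * (p * m)) one_pos
    (by intro e; rw [one_mul]; exact h2 1 zero_le_one (by simp) e) (by rw [h3]; simpa using hqm)
  rw [hc] at this
  push_cast at this
  rw [show p * 1 ^ 2 * (m : ℝ) - 1 * (2 * (p * m)) = - (p * m) by ring] at this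
  refine le_trans ?_ this
  norm_cast
  refine Finset.card_le_card ?_
  intro Ω hΩ
  simp only [Finset.mem_filter] at hΩ ⊢
  refine ⟨hΩ.1, lt_of_lt_of_le ?_ (le_abs_self _)⟩
  rw [h1, h1]
  simp only [Finset.mem_univ, if_true, mul_one, Finset.sum_const, Finset.card_univ,
    Fintype.card_fin, nsmul_eq_mul]
  have : p * q ≤ p * m := by gcongr
  have h4 := hΩ.2
  norm_cast at h4 this ⊢
  linarith

lemma ev_line {β : Type} [Fintype β] (m n S : ℕ) (hm : 12 ≤ m) (hn : 1 ≤ n) (hnm : n ≤ m)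
    (hS : S ≤ m * n) (p : ℝ) (hp : p = (S : ℝ) / (m * n)) (q r : ℕ)
    (hβ : Fintype.card β ≤ m)
    (emb : β → Fin q → Fin m × Fin n) (hemb : ∀ b, Function.Injective (emb b))
    (U : Matrix (Fin q) (Fin r) ℝ) (hU : Uᵀ * U = 1) (s : ℝ) (hs : 0 < s)
    (hu : ∀ i, ∑ k, U i k ^ 2 ≤ s) 
    (hps : 6400 * s * (132 * r + 10 * Real.log m) ≤ p) :
    (((Finset.powersetCard S (Finset.univ : Finset (Fin m × Fin n))).filter
      (fun Ω => ∃ b ∈ (Finset.univ : Finset β) ×ˢ (gridZ r ×ˢ gridZ r),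
        p / 40 < |∑ x, ((if emb b.1 x ∈ Ω then (1 : ℝ) else 0) - p) *
          ((∑ k, U x k * gsc r b.2.1 k) * (∑ k, U x k * gsc r b.2.2 k))|)).card : ℝ) ≤
      ((Finset.powersetCard S (Finset.univ : Finset (Fin m × Fin n))).card : ℝ) *
        Real.exp (- (5 * Real.log m)) := by
  have hm0 : (0 : ℝ) < m := by positivity
  have hp0 : 0 ≤ p := by rw [hp]; positivity
  have hc : Fintype.card (Fin m × Fin n) = m * n := by simp
  refine ev_gen m n hm hn hnm _ _ _ (Real.log m + (66 * r + 66 * r)) (- (p / (6400 * s))) ?_ ?_ ?_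
  · rw [Finset.card_product, Finset.card_product, Finset.card_univ, Real.exp_add, Real.exp_add,
      Real.exp_log hm0]
    push_cast
    have := gridZ_card r
    have h2 : (Fintype.card β : ℝ) ≤ m := by exact_mod_cast hβ
    gcongr
  · rintro ⟨b, w, v⟩ hb
    simp only [Finset.mem_product] at hb
    have hw := gsc_sq r w hb.2.1
    have hv := gsc_sq r v hb.2.2
    have hcs : ∀ x, ∀ w : Fin r → ℝ, ∑ k, w k ^ 2 ≤ 1 → (∑ k, U x k * w k) ^ 2 ≤ s := by
      intro x w hw
      refine (Finset.sum_mul_sq_le_sq_mul_sq _ _ _).trans ?_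
      have h1 := hu x
      have h0 : 0 ≤ ∑ k, w k ^ 2 := Finset.sum_nonneg fun _ _ => sq_nonneg _
      nlinarith
    have hiso : ∀ w : Fin r → ℝ, ∑ x, (∑ k, U x k * w k) ^ 2 = ∑ k, w k ^ 2 := by
      intro w
      have h1 : ∑ x, (∑ k, U x k * w k) ^ 2 = (U *ᵥ w) ⬝ᵥ (U *ᵥ w) := by
        simp [dotProduct, mulVec, sq]
      rw [h1, Matrix.dotProduct_mulVec, Matrix.vecMul_mulVec, hU, Matrix.vecMul_one]
      simp [dotProduct, sq]
    obtain ⟨g, h1, h2, h3⟩ := line_sum (emb b) (hemb b)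
      (fun x => (∑ k, U x k * gsc r w k) * (∑ k, U x k * gsc r v k))
    have := aux_bern S (by rw [hc]; positivity) (by rw [hc]; exact hS) p
      (by rw [hc, hp]; push_cast; ring) g (1 / (80 * s)) s (p / 40) (by positivity)
      (by
        intro e
        have := h2 s hs.le (by
          intro x
          rw [← Real.sqrt_sq_eq_abs]
          refine Real.sqrt_le_iff.2 ⟨hs.le, ?_⟩
          rw [mul_pow, sq s]
          exact mul_le_mul (hcs x _ hw) (hcs x _ hv) (sq_nonneg _) hs.le) e
        calc _ ≤ 1 / (80 * s) * s := by gcongr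
          _ = 1 / 80 := by field_simp
          _ ≤ 1 := by norm_num)
      (by
        rw [h3]
        calc _ ≤ ∑ x, (∑ k, U x k * gsc r w k) ^ 2 * s := by
              refine Finset.sum_le_sum fun x _ => ?_
              rw [mul_pow]
              exact mul_le_mul_of_nonneg_left (hcs x _ hv) (sq_nonneg _)
          _ = (∑ k, gsc r w k ^ 2) * s := by rw [← Finset.sum_mul, hiso]
          _ ≤ 1 * s := by gcongr
          _ = s := one_mul _)
    rw [hc] at this
    push_cast at this
    rw [show p * (1 / (80 * s)) ^ 2 * s - 1 / (80 * s) * (p / 40) = - (p / (6400 * s)) by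
      field_simp; ring] at this
    refine le_trans ?_ this
    refine Nat.cast_le.2 (Finset.card_le_card ?_)
    intro Ω hΩ
    simp only [Finset.mem_filter] at hΩ ⊢
    refine ⟨hΩ.1, ?_⟩
    rw [h1, h1]
    simp only [Finset.mem_univ, if_true, one_mul]
    rw [Finset.mul_sum, ← Finset.sum_sub_distrib]
    convert hΩ.2 using 3
    ring
  · have : 132 * r + 10 * Real.log m ≤ p / (6400 * s) := by
      rw [le_div_iff₀ (by positivity)]; linarith
    linarith

lemma line_good {m n q r : ℕ} (f : Fin q → Fin m × Fin n) (Ω : Finset (Fin m × Fin n)) (p : ℝ)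
    (U : Matrix (Fin q) (Fin r) ℝ)
    (h : ∀ z ∈ gridZ r, ∀ w ∈ gridZ r, |∑ x, ((if f x ∈ Ω then (1 : ℝ) else 0) - p) *
          ((∑ k, U x k * gsc r z k) * (∑ k, U x k * gsc r w k))| ≤ p / 40) (w : Fin r → ℝ) :
    |∑ x, ((if f x ∈ Ω then (1 : ℝ) else 0) - p) * (∑ k, U x k * w k) ^ 2| ≤
      p / 20 * ∑ k, w k ^ 2 := by
  have key : ∀ y z : Fin r → ℝ, ∑ x, ((if f x ∈ Ω then (1 : ℝ) else 0) - p) *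
          ((∑ k, U x k * y k) * (∑ k, U x k * z k)) =
      ∑ k, ∑ l, (∑ x, ((if f x ∈ Ω then (1 : ℝ) else 0) - p) * (U x k * U x l)) * (y k * z l) := by
    intro y z
    simp_rw [Finset.sum_mul_sum, Finset.mul_sum, Finset.sum_mul]
    rw [Finset.sum_comm]
    refine Finset.sum_congr rfl fun k _ => ?_
    rw [Finset.sum_comm]
    refine Finset.sum_congr rfl fun l _ => Finset.sum_congr rfl fun x _ => ?_
    ring
  have := net_bilin r r (fun k l => ∑ x, ((if f x ∈ Ω then (1 : ℝ) else 0) - p) * (U x k * U x l))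
    (p / 40) (by intro z hz w hw; rw [← key]; exact h z hz w hw) w w
  rw [← key, Real.mul_self_sqrt (Finset.sum_nonneg fun _ _ => sq_nonneg _)] at this
  simp_rw [sq (∑ k, U _ k * w k)]
  linarith

lemma ev_light (m n S : ℕ) (hm : 12 ≤ m) (hn : 1 ≤ n) (hnm : n ≤ m)
    (hS : S ≤ m * n) (p d : ℝ) (hp : p = (S : ℝ) / (m * n)) (hd : 1 ≤ d) (hpd : p * m = d) :
    (((Finset.powersetCard S (Finset.univ : Finset (Fin m × Fin n))).filter
      (fun Ω => ∃ b ∈ gridZ m ×ˢ gridZ n,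
        160 * Real.sqrt d < |∑ e ∈ Ω, (if |gsc m b.1 e.1 * gsc n b.2 e.2| ≤ Real.sqrt d / m then
          gsc m b.1 e.1 * gsc n b.2 e.2 else 0) -
        p * ∑ e : Fin m × Fin n, (if |gsc m b.1 e.1 * gsc n b.2 e.2| ≤ Real.sqrt d / m then
          gsc m b.1 e.1 * gsc n b.2 e.2 else 0)|)).card : ℝ) ≤
      ((Finset.powersetCard S (Finset.univ : Finset (Fin m × Fin n))).card : ℝ) *
        Real.exp (- (5 * Real.log m)) := by
  have hm0 : (0 : ℝ) < m := by positivity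
  have hp0 : 0 ≤ p := by rw [hp]; positivity
  have hc : Fintype.card (Fin m × Fin n) = m * n := by simp
  have hnm' : (n : ℝ) ≤ m := by exact_mod_cast hnm
  have hd0 : 0 < d := by linarith
  have hsd : 0 < Real.sqrt d := Real.sqrt_pos.2 hd0
  have hsd2 : Real.sqrt d ^ 2 = d := Real.sq_sqrt hd0.le
  have hlog : Real.log m ≤ m - 1 := Real.log_le_sub_one_of_pos hm0
  refine ev_gen m n hm hn hnm _ _ _ (66 * m + 66 * n) (m - 160 * m) ?_ ?_ (by linarith)
  · rw [Finset.card_product, Real.exp_add]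
    push_cast
    have := gridZ_card m
    have := gridZ_card n
    gcongr
  rintro ⟨z, w⟩ hb
  simp only [Finset.mem_product] at hb
  have hz := gsc_sq m z hb.1
  have hw := gsc_sq n w hb.2
  have := aux_bern S (by rw [hc]; positivity) (by rw [hc]; exact hS) p
      (by rw [hc, hp]; push_cast; ring)
      (fun e : Fin m × Fin n => (if |gsc m z e.1 * gsc n w e.2| ≤ Real.sqrt d / m then
          gsc m z e.1 * gsc n w e.2 else 0)) (m / Real.sqrt d) 1 (160 * Real.sqrt d)
      (by positivity)
      (by
        intro e
        have : |(if |gsc m z e.1 * gsc n w e.2| ≤ Real.sqrt d / m then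
          gsc m z e.1 * gsc n w e.2 else 0)| ≤ Real.sqrt d / m := by
          split_ifs with h
          · exact h
          · rw [abs_zero]; positivity
        calc _ ≤ m / Real.sqrt d * (Real.sqrt d / m) := by gcongr
          _ = 1 := by field_simp)
      (by
        calc _ ≤ ∑ e : Fin m × Fin n, gsc m z e.1 ^ 2 * gsc n w e.2 ^ 2 := by
              refine Finset.sum_le_sum fun e _ => ?_
              split_ifs
              · rw [mul_pow]
              · rw [zero_pow two_ne_zero]; positivity
          _ = (∑ i, gsc m z i ^ 2) * ∑ j, gsc n w j ^ 2 := by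
              rw [Finset.sum_mul_sum, Fintype.sum_prod_type]
          _ ≤ 1 * 1 := mul_le_mul hz hw (Finset.sum_nonneg fun _ _ => sq_nonneg _) zero_le_one
          _ = 1 := one_mul _)
  rw [hc] at this
  push_cast at this
  rw [show p * (m / Real.sqrt d) ^ 2 * 1 - m / Real.sqrt d * (160 * Real.sqrt d) =
      (m : ℝ) - 160 * m by
    rw [div_pow, hsd2, ← hpd]
    have : p ≠ 0 := by rintro rfl; simp at hpd; linarith
    have : Real.sqrt (p * m) ≠ 0 := by rw [hpd]; exact hsd.ne'
    field_simp] at this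
  exact this

lemma choose_le_hfun (m k : ℕ) (hk : 1 ≤ k) (hkm : k ≤ m) :
    (m.choose k : ℝ) ≤ Real.exp (hfun m k) := by
  have hk0 : (0 : ℝ) < k := by exact_mod_cast hk
  have hm0 : (0 : ℝ) < m := by exact_mod_cast (by omega : 0 < m)
  have h1 : (m.choose k : ℝ) ≤ (m : ℝ) ^ k / (k.factorial : ℝ) := Nat.choose_le_pow_div k m
  have h2 := Real.pow_div_factorial_le_exp (k : ℝ) hk0.le k
  have hf : (0 : ℝ) < k.factorial := by exact_mod_cast Nat.factorial_pos k
  have e1 : Real.exp (hfun m k) = Real.exp k * (m : ℝ) ^ k / (k : ℝ) ^ k := by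
    rw [hfun, show (k : ℝ) * (1 + Real.log m - Real.log k) =
      k + k * Real.log m - k * Real.log k by ring, Real.exp_sub, Real.exp_add,
      Real.exp_nat_mul, Real.exp_nat_mul, Real.exp_log hm0, Real.exp_log hk0]
  rw [e1]
  refine h1.trans ?_
  rw [div_le_iff₀ hf] at h2
  rw [div_le_div_iff₀ hf (by positivity)]
  have : (0 : ℝ) ≤ (m : ℝ) ^ k := by positivity
  nlinarith

lemma hfun_ge (m k : ℕ) (hk : 1 ≤ k) (hkm : k ≤ m) : 1 + Real.log m ≤ hfun m k := by
  have hk0 : (1 : ℝ) ≤ k := by exact_mod_cast hk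
  have hkm' : (k : ℝ) ≤ m := by exact_mod_cast hkm
  have h1 := Real.log_le_log (by linarith) hkm'
  have h2 := Real.log_le_sub_one_of_pos (by linarith : (0 : ℝ) < k)
  rw [hfun]
  nlinarith

lemma hsum (m a : ℕ) (ha : a ≤ m) (hm : 1 ≤ m) :
    ∑ I ∈ (Finset.univ : Finset (Finset (Fin a))).filter (fun I => I.Nonempty),
      Real.exp (- (10 * hfun m I.card)) ≤ Real.exp (- (8 * Real.log m)) := by
  have hm0 : (0 : ℝ) < m := by exact_mod_cast hm
  set F : ℕ → ℝ := fun k => if k = 0 then 0 else Real.exp (- (10 * hfun m k)) with hF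
  have h1 : ∑ I ∈ (Finset.univ : Finset (Finset (Fin a))).filter (fun I => I.Nonempty),
      Real.exp (- (10 * hfun m I.card)) = ∑ I ∈ (Finset.univ : Finset (Fin a)).powerset, F I.card := by
    rw [Finset.powerset_univ, Finset.sum_filter]
    refine Finset.sum_congr rfl fun I _ => ?_
    simp only [hF, Finset.card_eq_zero, Finset.nonempty_iff_ne_empty]
    split_ifs <;> simp_all
  rw [h1, Finset.sum_powerset_apply_card, Finset.sum_range_succ']
  have h2 : F 0 = 0 := by simp [hF]
  rw [h2, smul_zero, add_zero, Finset.card_univ, Fintype.card_fin]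
  calc _ ≤ ∑ k ∈ Finset.range a, Real.exp (- (9 * Real.log m)) := by
        refine Finset.sum_le_sum fun k hk => ?_
        have hk : k + 1 ≤ a := by simpa using hk
        have h3 := choose_le_hfun m (k + 1) (by omega) (by omega)
        have h4 := hfun_ge m (k + 1) (by omega) (by omega)
        have h5 : (a.choose (k + 1) : ℝ) ≤ m.choose (k + 1) := by
          exact_mod_cast Nat.choose_le_choose _ ha
        rw [nsmul_eq_mul, hF]
        simp only [Nat.succ_ne_zero, if_false]
        calc _ ≤ Real.exp (hfun m (k + 1)) * Real.exp (- (10 * hfun m (k + 1))) := by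
              gcongr; linarith
          _ = Real.exp (- (9 * hfun m (k + 1))) := by rw [← Real.exp_add]; ring_nf
          _ ≤ _ := by gcongr; linarith
    _ = a * Real.exp (- (9 * Real.log m)) := by simp
    _ ≤ m * Real.exp (- (9 * Real.log m)) := by gcongr
    _ = Real.exp (Real.log m) * Real.exp (- (9 * Real.log m)) := by rw [Real.exp_log hm0]
    _ = _ := by rw [← Real.exp_add]; ring_nf

lemma ev_disc (m n S : ℕ) (hm : 12 ≤ m) (hn : 1 ≤ n) (hnm : n ≤ m)
    (hS : S ≤ m * n) (p : ℝ) (hp : p = (S : ℝ) / (m * n)) :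
    (((Finset.powersetCard S (Finset.univ : Finset (Fin m × Fin n))).filter
      (fun Ω => ∃ b ∈ (Finset.Icc 1 m) ×ˢ
          (((Finset.univ : Finset (Finset (Fin m))).filter (fun I => I.Nonempty)) ×ˢ
          ((Finset.univ : Finset (Finset (Fin n))).filter (fun I => I.Nonempty))),
        p * Real.exp b.1 * (b.2.1.card * b.2.2.card) +
          10 * (hfun m b.2.1.card + hfun m b.2.2.card) <
        b.1 * ((Ω.filter (fun e => e.1 ∈ b.2.1 ∧ e.2 ∈ b.2.2)).card : ℝ))).card : ℝ) ≤
      ((Finset.powersetCard S (Finset.univ : Finset (Fin m × Fin n))).card : ℝ) *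
        Real.exp (- (5 * Real.log m)) := by
  have hm0 : (0 : ℝ) < m := by positivity
  have hm12 : (12 : ℝ) ≤ m := by exact_mod_cast hm
  have hnm' : (n : ℝ) ≤ m := by exact_mod_cast hnm
  have hp0 : 0 ≤ p := by rw [hp]; positivity
  have hc : Fintype.card (Fin m × Fin n) = m * n := by simp
  set P := Finset.powersetCard S (Finset.univ : Finset (Fin m × Fin n)) with hP
  refine (aux_union P _ _ (fun b => ((m : ℝ) * n + 1) * (P.card : ℝ) *
    (Real.exp (- (10 * hfun m b.2.1.card)) * Real.exp (- (10 * hfun m b.2.2.card)))) ?_).trans ?_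
  · rintro ⟨φ, I, J⟩ hb
    dsimp only
    have := aux_markov S (by rw [hc]; positivity) (by rw [hc]; exact hS) p
      (by rw [hc, hp]; push_cast; ring)
      (fun e : Fin m × Fin n => if e.1 ∈ I ∧ e.2 ∈ J then (φ : ℝ) else 0)
      (p * Real.exp φ * (I.card * J.card) + 10 * (hfun m I.card + hfun m J.card))
    rw [hc] at this
    push_cast at this
    have hs : ∀ Ω : Finset (Fin m × Fin n), ∑ e ∈ Ω, (if e.1 ∈ I ∧ e.2 ∈ J then (φ : ℝ) else 0) =
        φ * ((Ω.filter (fun e => e.1 ∈ I ∧ e.2 ∈ J)).card : ℝ) := by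
      intro Ω
      rw [← Finset.sum_filter, Finset.sum_const, nsmul_eq_mul, mul_comm]
    simp_rw [hs] at this
    refine this.trans ?_
    have h2 : ∑ e : Fin m × Fin n, (Real.exp (if e.1 ∈ I ∧ e.2 ∈ J then (φ : ℝ) else 0) - 1) ≤
        Real.exp φ * (I.card * J.card) := by
      calc _ = ∑ e : Fin m × Fin n, (if e.1 ∈ I ∧ e.2 ∈ J then (Real.exp φ - 1) else 0) := by
            refine Finset.sum_congr rfl fun e _ => ?_
            split_ifs <;> simp
        _ = ∑ e ∈ I ×ˢ J, (Real.exp φ - 1) := by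
            rw [← Finset.sum_filter]
            refine Finset.sum_congr ?_ fun _ _ => rfl
            ext e; simp
        _ = (I.card * J.card) * (Real.exp φ - 1) := by simp; ring
        _ ≤ _ := by nlinarith [(by positivity : (0 : ℝ) ≤ (I.card : ℝ) * J.card)]
    rw [← Real.exp_add]
    have h3 := mul_le_mul_of_nonneg_left h2 hp0
    gcongr
    linarith
  · rw [← Finset.mul_sum, Finset.sum_product]
    simp_rw [Finset.sum_product]
    rw [Finset.sum_const, Nat.card_Icc, nsmul_eq_mul, ← Finset.sum_mul_sum]
    have h1 := hsum m m le_rfl (by omega)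
    have h2 := hsum m n hnm (by omega)
    have e1 : Real.exp (4 * Real.log m) = (m : ℝ) ^ 4 := by
      rw [mul_comm, Real.exp_mul, Real.exp_log hm0]; norm_cast
    have h3 : ((m : ℝ) * n + 1) ≤ Real.exp (4 * Real.log m) := by
      rw [e1]
      have : (m : ℝ) * n ≤ m * m := by gcongr
      nlinarith [sq_nonneg ((m : ℝ)), sq_nonneg ((m : ℝ) ^ 2 - 2)]
    have hl : 0 ≤ Real.log m := Real.log_nonneg (by linarith)
    have e2 : ((m + 1 - 1 : ℕ) : ℝ) = Real.exp (Real.log m) := by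
      rw [Real.exp_log hm0]; simp
    rw [e2]
    calc _ ≤ Real.exp (4 * Real.log m) * P.card * (Real.exp (Real.log m) *
          (Real.exp (- (8 * Real.log m)) * Real.exp (- (8 * Real.log m)))) := by
          gcongr
      _ = P.card * Real.exp (4 * Real.log m + (Real.log m +
          (- (8 * Real.log m) + - (8 * Real.log m)))) := by
          simp only [Real.exp_add]; ring
      _ ≤ _ := by gcongr; linarith

lemma union6 {α : Type*} (P : Finset α) (B1 B2 B3 B4 B5 B6 Q : α → Prop)
    {_ : DecidablePred B1} {_ : DecidablePred B2} {_ : DecidablePred B3} {_ : DecidablePred B4}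
    {_ : DecidablePred B5} {_ : DecidablePred B6} {_ : DecidablePred Q} (c : ℝ)
    (h1 : ((P.filter B1).card : ℝ) ≤ c) (h2 : ((P.filter B2).card : ℝ) ≤ c)
    (h3 : ((P.filter B3).card : ℝ) ≤ c) (h4 : ((P.filter B4).card : ℝ) ≤ c)
    (h5 : ((P.filter B5).card : ℝ) ≤ c) (h6 : ((P.filter B6).card : ℝ) ≤ c)
    (h : ∀ a ∈ P, ¬ B1 a → ¬ B2 a → ¬ B3 a → ¬ B4 a → ¬ B5 a → ¬ B6 a → Q a) :
    (P.card : ℝ) - 6 * c ≤ ((P.filter Q).card : ℝ) := by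
  have hsub : P ⊆ P.filter Q ∪ (P.filter B1 ∪ (P.filter B2 ∪ (P.filter B3 ∪
      (P.filter B4 ∪ (P.filter B5 ∪ P.filter B6))))) := by
    intro a ha
    have := h a ha
    simp only [Finset.mem_union, Finset.mem_filter, ha, true_and]
    tauto
  have e0 := Finset.card_le_card hsub
  have e1 := Finset.card_union_le (P.filter Q) (P.filter B1 ∪ (P.filter B2 ∪ (P.filter B3 ∪
      (P.filter B4 ∪ (P.filter B5 ∪ P.filter B6)))))
  have e2 := Finset.card_union_le (P.filter B1) (P.filter B2 ∪ (P.filter B3 ∪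
      (P.filter B4 ∪ (P.filter B5 ∪ P.filter B6))))
  have e3 := Finset.card_union_le (P.filter B2) (P.filter B3 ∪
      (P.filter B4 ∪ (P.filter B5 ∪ P.filter B6)))
  have e4 := Finset.card_union_le (P.filter B3) (P.filter B4 ∪ (P.filter B5 ∪ P.filter B6))
  have e5 := Finset.card_union_le (P.filter B4) (P.filter B5 ∪ P.filter B6)
  have e6 := Finset.card_union_le (P.filter B5) (P.filter B6)
  have : (P.card : ℝ) ≤ (P.filter Q).card + ((P.filter B1).card + ((P.filter B2).card +
      ((P.filter B3).card + ((P.filter B4).card + ((P.filter B5).card + (P.filter B6).card))))) := by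
    exact_mod_cast (by omega)
  linarith

set_option maxHeartbeats 400000 in
lemma prob_good (m n r S : ℕ) (hm : 12 ≤ m) (hn : 1 ≤ n) (hnm : n ≤ m)
    (hS : S ≤ m * n) (p d : ℝ) (hp : p = (S : ℝ) / (m * n)) (hd : 1 ≤ d) (hpd : p * m = d)
    (hdl : 10 * Real.log m ≤ p * m)
    (U : Matrix (Fin m) (Fin r) ℝ) (hU : Uᵀ * U = 1) (su : ℝ) (hsu : 0 < su)
    (hu : ∀ i, ∑ k, U i k ^ 2 ≤ su)
    (hpu : 6400 * su * (132 * r + 10 * Real.log m) ≤ p)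
    (V : Matrix (Fin n) (Fin r) ℝ) (hV : Vᵀ * V = 1) (sv : ℝ) (hsv : 0 < sv)
    (hv : ∀ i, ∑ k, V i k ^ 2 ≤ sv)
    (hpv : 6400 * sv * (132 * r + 10 * Real.log m) ≤ p)
    (Q : Finset (Fin m × Fin n) → Prop)
    (hQ : ∀ Ω : Finset (Fin m × Fin n),
      (∀ (x : Fin m → ℝ) (y : Fin n → ℝ),
        |∑ i, ∑ j, ((if (i, j) ∈ Ω then 1 else 0) - p) * (x i * y j)| ≤
        (18934 * Real.sqrt d) * (Real.sqrt (∑ i, x i ^ 2) * Real.sqrt (∑ j, y j ^ 2))) →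
      (∀ (j : Fin n) (w : Fin r → ℝ),
        |∑ i, ((if (i, j) ∈ Ω then 1 else 0) - p) * (∑ k, U i k * w k) ^ 2| ≤
          p / 20 * ∑ k, w k ^ 2) →
      (∀ (i : Fin m) (w : Fin r → ℝ),
        |∑ j, ((if (i, j) ∈ Ω then 1 else 0) - p) * (∑ k, V j k * w k) ^ 2| ≤
          p / 20 * ∑ k, w k ^ 2) → Q Ω) :
    (1 - 1 / (2 * (n : ℝ) ^ 4)) *
      ((Finset.powersetCard S (Finset.univ : Finset (Fin m × Fin n))).card : ℝ) ≤
    (((Finset.powersetCard S (Finset.univ : Finset (Fin m × Fin n))).filter Q).card : ℝ) := by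
  have hm0 : (0 : ℝ) < m := by positivity
  have hm12 : (12 : ℝ) ≤ m := by exact_mod_cast hm
  have hnm' : (n : ℝ) ≤ m := by exact_mod_cast hnm
  have hn0 : (1 : ℝ) ≤ n := by exact_mod_cast hn
  have injr : ∀ i : Fin m, Function.Injective (fun x : Fin n => (i, x)) :=
    fun i x y h => (Prod.mk.inj h).2
  have injc : ∀ j : Fin n, Function.Injective (fun x : Fin m => (x, j)) :=
    fun i x y h => (Prod.mk.inj h).1
  have b1 := ev_row m n S hm hn hnm hS p hp n hnm (by simp) hdl
    (fun (i : Fin m) (x : Fin n) => (i, x)) injr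
  have b2 := ev_row m n S hm hn hnm hS p hp m le_rfl (by simpa using hnm) hdl
    (fun (j : Fin n) (x : Fin m) => (x, j)) injc
  have b3 := ev_disc m n S hm hn hnm hS p hp
  have b4 := ev_light m n S hm hn hnm hS p d hp hd hpd
  have b5 := ev_line m n S hm hn hnm hS p hp m r (by simpa using hnm)
    (fun (j : Fin n) (x : Fin m) => (x, j)) injc U hU su hsu hu hpu
  have b6 := ev_line m n S hm hn hnm hS p hp n r (by simp)
    (fun (i : Fin m) (x : Fin n) => (i, x)) injr V hV sv hsv hv hpv
  set P := Finset.powersetCard S (Finset.univ : Finset (Fin m × Fin n)) with hP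
  have hexp : Real.exp (- (5 * Real.log m)) = 1 / (m : ℝ) ^ 5 := by
    rw [Real.exp_neg, one_div, mul_comm, Real.exp_mul, Real.exp_log hm0]; norm_cast
  rw [hexp] at b1 b2 b3 b4 b5 b6
  refine le_trans ?_ (union6 P _ _ _ _ _ _ Q _ b1 b2 b3 b4 b5 b6 ?_)
  swap
  · intro Ω hΩ c1 c2 c3 c4 c5 c6
    push Not at c1 c2 c3 c4 c5 c6
    refine hQ Ω ?_ ?_ ?_
    · intro x y
      have := spec m n (by omega) p d 160 hd hpd Ω ⟨?_, ?_, ?_⟩ ?_ x y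
      · refine this.trans (le_of_eq ?_)
        ring
      · intro i
        have h1 := c1 i (Finset.mem_univ _)
        rw [hpd] at h1
        refine le_trans (le_of_eq ?_) h1
        have h2 : ((Ω.filter (fun e => e.1 = i)).card : ℝ) =
            ∑ e : Fin m × Fin n, if e.1 = i ∧ e ∈ Ω then (1 : ℝ) else 0 := by
          rw [← Finset.sum_filter, Finset.sum_const, nsmul_eq_mul, mul_one]
          congr 2
          ext e; simp [and_comm]
        rw [h2, Fintype.sum_prod_type, Finset.sum_eq_single i]
        · simp
        · intro b _ hb; simp [hb]
        · simp
      · intro j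
        have h1 := c2 j (Finset.mem_univ _)
        rw [hpd] at h1
        refine le_trans (le_of_eq ?_) h1
        have h2 : ((Ω.filter (fun e => e.2 = j)).card : ℝ) =
            ∑ e : Fin m × Fin n, if e.2 = j ∧ e ∈ Ω then (1 : ℝ) else 0 := by
          rw [← Finset.sum_filter, Finset.sum_const, nsmul_eq_mul, mul_one]
          congr 2
          ext e; simp [and_comm]
        rw [h2, Fintype.sum_prod_type_right, Finset.sum_eq_single j]
        · simp
        · intro b _ hb; simp [hb]
        · simp
      · intro I J hI hJ φ h1 h2
        exact c3 (φ, I, J) (by simp [h1, h2, hI, hJ])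
      · intro z hz w hw
        exact c4 (z, w) (by simp [hz, hw])
    · intro j w
      exact line_good (fun x : Fin m => (x, j)) Ω p U
        (fun z hz w hw => c5 (j, z, w) (by simp [hz, hw])) w
    · intro i w
      exact line_good (fun x : Fin n => (i, x)) Ω p V
        (fun z hz w hw => c6 (i, z, w) (by simp [hz, hw])) w
  clear b1 b2 b3 b4 b5 b6 hQ
  have h7 : 6 * (1 / (m : ℝ) ^ 5) ≤ 1 / (2 * (n : ℝ) ^ 4) := by
    rw [mul_one_div, div_le_div_iff₀ (by positivity) (by positivity)]
    have : (n : ℝ) ^ 4 ≤ m ^ 4 := by gcongr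
    have h8 : (12 : ℝ) * m ^ 4 ≤ m * m ^ 4 := by gcongr
    nlinarith
  have h9 : (0 : ℝ) ≤ P.card := by positivity
  nlinarith [mul_le_mul_of_nonneg_left h7 h9]

lemma arith_main (m n r S : ℕ) (μ κ p : ℝ) (hn : 1 ≤ n) (hnm : n ≤ m) (hr : 1 ≤ r) (hμ : 1 ≤ μ)
    (hκ : 1 ≤ κ) (hS : S ≤ m * n) (hp : p = (S : ℝ) / (m * n))
    (h : (10 : ℝ) ^ 16 * ((m : ℝ) / n) * n * r * κ ^ 2 * max (μ * Real.log n)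
      (Real.sqrt ((m : ℝ) / n) * μ ^ 2 * (r : ℝ) ^ 6 * κ ^ 4) ≤ S) :
    12 ≤ m ∧ 0 ≤ p ∧ 1 ≤ p * m ∧ 10 * Real.log m ≤ p * m ∧
    6400 * (μ * r / m) * (132 * r + 10 * Real.log m) ≤ p ∧
    6400 * (μ * r / n) * (132 * r + 10 * Real.log m) ≤ p ∧
    1920 * (r : ℝ) ^ 2 * κ ^ 2 * ((18934 * Real.sqrt (p * m)) *
      (Real.sqrt (μ * r / m) * Real.sqrt (μ * r / n))) ≤ p := by
  have hm0 : (0 : ℝ) < m := by exact_mod_cast (by omega : 0 < m)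
  have hn1 : (1 : ℝ) ≤ n := by exact_mod_cast hn
  have hn0 : (0 : ℝ) < n := by linarith
  have hr1 : (1 : ℝ) ≤ r := by exact_mod_cast hr
  have hnm' : (n : ℝ) ≤ m := by exact_mod_cast hnm
  have hp0 : 0 ≤ p := by rw [hp]; positivity
  have hSr : (S : ℝ) ≤ m * n := by exact_mod_cast hS
  have hp1 : p ≤ 1 := by rw [hp, div_le_one (by positivity)]; exact hSr
  obtain ⟨q, hq⟩ : ∃ q, q = p * n := ⟨_, rfl⟩
  have hqn : q ≤ n := by rw [hq]; nlinarith
  have hqS : q * m = S := by rw [hq, hp]; field_simp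
  have hqm : q ≤ p * m := by rw [hq]; gcongr
  set α := (m : ℝ) / n with hα
  have hα1 : 1 ≤ α := by rw [hα, le_div_iff₀ hn0]; linarith
  have hsα : 1 ≤ Real.sqrt α := Real.one_le_sqrt.2 hα1
  have hln : 0 ≤ Real.log n := Real.log_nonneg hn1
  have e1 : α * n = m := by rw [hα]; field_simp
  set Z := max (μ * Real.log n) (Real.sqrt α * μ ^ 2 * (r : ℝ) ^ 6 * κ ^ 4) with hZ
  have hqZ : 10 ^ 16 * r * κ ^ 2 * Z ≤ q := by
    have : 10 ^ 16 * r * κ ^ 2 * Z * m ≤ q * m := by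
      rw [hqS]; refine le_trans (le_of_eq ?_) h
      rw [← e1]; ring
    exact le_of_mul_le_mul_right this hm0
  have hκ2 : 1 ≤ κ ^ 2 := one_le_pow₀ hκ
  have hq1 : 10 ^ 16 * (r * (μ * Real.log n)) ≤ q := by
    refine le_trans ?_ hqZ
    calc 10 ^ 16 * (r * (μ * Real.log n)) = 10 ^ 16 * r * 1 * (μ * Real.log n) := by ring
      _ ≤ _ := by gcongr; exact le_max_left _ _
  have hq2 : 10 ^ 16 * (Real.sqrt α * (μ ^ 2 * (r : ℝ) ^ 7 * κ ^ 6)) ≤ q := by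
    refine le_trans ?_ hqZ
    calc 10 ^ 16 * (Real.sqrt α * (μ ^ 2 * (r : ℝ) ^ 7 * κ ^ 6)) =
        10 ^ 16 * r * κ ^ 2 * (Real.sqrt α * μ ^ 2 * (r : ℝ) ^ 6 * κ ^ 4) := by ring
      _ ≤ _ := by gcongr; exact le_max_right _ _
  have hW1 : 1 ≤ μ ^ 2 * (r : ℝ) ^ 7 * κ ^ 6 :=
    one_le_mul_of_one_le_of_one_le (one_le_mul_of_one_le_of_one_le (one_le_pow₀ hμ)
      (one_le_pow₀ hr1)) (one_le_pow₀ hκ)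
  have hq3 : 10 ^ 16 * Real.sqrt α ≤ q := by
    refine le_trans ?_ hq2
    have : Real.sqrt α * 1 ≤ Real.sqrt α * (μ ^ 2 * (r : ℝ) ^ 7 * κ ^ 6) := by gcongr
    linarith
  have hq4 : 10 ^ 16 * (μ ^ 2 * (r : ℝ) ^ 7 * κ ^ 6) ≤ q := by
    refine le_trans ?_ hq2
    have : 1 * (μ ^ 2 * (r : ℝ) ^ 7 * κ ^ 6) ≤ Real.sqrt α * (μ ^ 2 * (r : ℝ) ^ 7 * κ ^ 6) := by
      gcongr
    linarith
  have hq16 : 10 ^ 16 ≤ q := by linarith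
  have hq0 : 0 < q := by linarith
  -- m at most n cubed
  have hmn3 : (m : ℝ) ≤ n ^ 3 := by
    have h1 : Real.sqrt α ≤ n := by linarith
    have h2 : α ≤ n ^ 2 := by
      rw [← Real.sq_sqrt (by linarith : 0 ≤ α)]; gcongr
    rw [← e1]; nlinarith
  have hlm : Real.log m ≤ 3 * Real.log n := by
    have := Real.log_le_log hm0 hmn3
    rw [Real.log_pow] at this
    exact_mod_cast this
  have hlm0 : 0 ≤ Real.log m := Real.log_nonneg (by linarith)
  have hq5 : 10 ^ 15 * (μ * r * Real.log m) ≤ q := by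
    have : μ * r * Real.log m ≤ μ * r * (3 * Real.log n) := by gcongr
    nlinarith [mul_nonneg (by positivity : 0 ≤ μ * r) hln]
  have hμr : 1 ≤ μ * r := one_le_mul_of_one_le_of_one_le hμ hr1
  have hq6 : 10 ^ 16 * (μ * r * r) ≤ q := by
    refine le_trans ?_ hq4
    have h1 : μ ≤ μ ^ 2 := le_self_pow₀ hμ two_ne_zero
    have h2 : (r : ℝ) ^ 2 ≤ r ^ 7 := pow_le_pow_right₀ hr1 (by norm_num)
    have h3 : 1 ≤ κ ^ 6 := one_le_pow₀ hκ
    calc (10 : ℝ) ^ 16 * (μ * r * r) = 10 ^ 16 * (μ * r ^ 2 * 1) := by ring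
      _ ≤ _ := by gcongr
  have hv : 6400 * (μ * r / n) * (132 * r + 10 * Real.log m) ≤ p := by
    have hpq : p = q / n := by rw [hq]; field_simp
    rw [hpq, show 6400 * (μ * r / n) * (132 * r + 10 * Real.log m) =
      (6400 * 132 * (μ * r * r) + 64000 * (μ * r * Real.log m)) / n by ring]
    gcongr
    have : 0 ≤ μ * r * r := by positivity
    have : 0 ≤ μ * r * Real.log m := by positivity
    linarith
  refine ⟨?_, hp0, by linarith, ?_, ?_, hv, ?_⟩
  · have : (12 : ℝ) ≤ m := by linarith
    exact_mod_cast this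
  · have : 1 * Real.log m ≤ μ * r * Real.log m := by gcongr
    linarith
  · refine le_trans ?_ hv
    gcongr
  · have hsu : Real.sqrt (p * m) * (Real.sqrt (μ * r / m) * Real.sqrt (μ * r / n)) =
        μ * r * Real.sqrt q / n := by
      rw [← Real.sqrt_mul (by positivity), ← Real.sqrt_mul (by positivity)]
      rw [show p * m * (μ * r / m * (μ * r / n)) = (μ * r / n) ^ 2 * q by
        rw [hq]; field_simp]
      rw [Real.sqrt_mul (by positivity), Real.sqrt_sq (by positivity)]
      ring
    have hB : 36353280 * (r ^ 3 * κ ^ 2 * μ) ≤ Real.sqrt q := by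
      refine Real.le_sqrt_of_sq_le ?_
      refine le_trans ?_ hq4
      have h2 : (r : ℝ) ^ 6 ≤ r ^ 7 := pow_le_pow_right₀ hr1 (by norm_num)
      have h3 : κ ^ 4 ≤ κ ^ 6 := pow_le_pow_right₀ hκ (by norm_num)
      calc (36353280 * ((r : ℝ) ^ 3 * κ ^ 2 * μ)) ^ 2 =
          36353280 ^ 2 * (μ ^ 2 * r ^ 6 * κ ^ 4) := by ring
        _ ≤ 10 ^ 16 * (μ ^ 2 * (r : ℝ) ^ 7 * κ ^ 6) := by
          gcongr
          norm_num
    calc _ = 1920 * (r : ℝ) ^ 2 * κ ^ 2 * 18934 *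
          (Real.sqrt (p * m) * (Real.sqrt (μ * r / m) * Real.sqrt (μ * r / n))) := by ring
      _ = 36353280 * (r ^ 3 * κ ^ 2 * μ) * Real.sqrt q / n := by rw [hsu]; ring
      _ ≤ Real.sqrt q * Real.sqrt q / n := by gcongr
      _ = p := by rw [Real.mul_self_sqrt hq0.le, hq]; field_simp

/-- **Lemma: restricted strong convexity of the sampling operator.**
Probability is expressed by counting: among all subsets `Ω ⊆ [m]×[n]` of cardinality `S`
(the uniform sample model), the fraction for which the conclusion holds is at least
`1 - 1/(2n⁴)`. -/
theorem stmt10 :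
    ∃ C0 Cd CT : ℝ, 0 < C0 ∧ 0 < Cd ∧ 0 < CT ∧
      ∀ (m n r : ℕ) (μ : ℝ) (M : Matrix (Fin m) (Fin n) ℝ)
        (Uh : Matrix (Fin m) (Fin r) ℝ) (Vh : Matrix (Fin n) (Fin r) ℝ)
        (σ : Fin r → ℝ) (Smax Smin : ℝ),
        1 ≤ n → n ≤ m → 1 ≤ r → 1 ≤ μ →
        Uhᵀ * Uh = 1 → Vhᵀ * Vh = 1 →
        (∀ k, 0 < σ k) → (∀ k l : Fin r, k ≤ l → σ l ≤ σ k) →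
        M = Uh * Matrix.diagonal σ * Vhᵀ →
        ((∀ k, σ k ≤ Smax) ∧ ∃ k, σ k = Smax) →
        ((∀ k, Smin ≤ σ k) ∧ ∃ k, σ k = Smin) →
        (∀ i, ∑ k, Uh i k ^ 2 ≤ μ * r / m) →
        (∀ j, ∑ k, Vh j k ^ 2 ≤ μ * r / n) →
        ∀ S : ℕ,
          C0 * ((m : ℝ) / n) * n * r * (Smax / Smin) ^ 2 *
              max (μ * Real.log n)
                (Real.sqrt ((m : ℝ) / n) * μ ^ 2 * (r : ℝ) ^ 6 * (Smax / Smin) ^ 4) ≤ S →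
          let κ : ℝ := Smax / Smin
          let δ : ℝ := Smin / (Cd * (r : ℝ) ^ ((3 : ℝ) / 2) * κ)
          let p : ℝ := (S : ℝ) / (m * n)
          let βT : ℝ := Real.sqrt (CT * r * Smax)
          let β1 : ℝ := βT * Real.sqrt (3 * μ * r / m)
          let β2 : ℝ := βT * Real.sqrt (3 * μ * r / n)
          (1 - 1 / (2 * (n : ℝ) ^ 4)) *
              ((Finset.powersetCard S (Finset.univ : Finset (Fin m × Fin n))).card : ℝ) ≤
            (((Finset.powersetCard S (Finset.univ : Finset (Fin m × Fin n))).filter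
                (fun Ω =>
                  ∀ (X : Matrix (Fin m) (Fin r) ℝ) (Y : Matrix (Fin n) (Fin r) ℝ),
                    K1mem β1 β2 X Y → K2mem βT X Y → Kmem M δ X Y →
                    1 / 3 * p * frob (M - X * Yᵀ) ^ 2 ≤
                        frob (projOmega Ω (M - X * Yᵀ)) ^ 2 ∧
                      frob (projOmega Ω (M - X * Yᵀ)) ^ 2 ≤
                        2 * p * frob (M - X * Yᵀ) ^ 2)).card : ℝ) := by
  refine ⟨10 ^ 16, 100, 1, by norm_num, by norm_num, by norm_num, ?_⟩
  intro m n r μ M U V σ Smax Smin hn hnm hr hμ hU hV hσ0 _ hM hmax hmin hu hv S hS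
  intro κ δ p βT β1 β2
  have hm0 : (0 : ℝ) < m := by exact_mod_cast (by omega : 0 < m)
  have hn0 : (0 : ℝ) < n := by exact_mod_cast (by omega : 0 < n)
  have hr1 : (1 : ℝ) ≤ r := by exact_mod_cast hr
  by_cases hSmn : S ≤ m * n
  swap
  · have : Finset.powersetCard S (Finset.univ : Finset (Fin m × Fin n)) = ∅ := by
      rw [Finset.powersetCard_eq_empty]
      simp; omega
    rw [this]; simp
  have hs0 : 0 < Smin := by obtain ⟨k, hk⟩ := hmin.2; rw [← hk]; exact hσ0 k
  have hκ1 : 1 ≤ κ := by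
    obtain ⟨k, hk⟩ := hmin.2
    have := hmax.1 k
    show 1 ≤ Smax / Smin
    rw [le_div_iff₀ hs0]; linarith
  have hκ0 : 0 < κ := by linarith
  obtain ⟨a1, a2, a3, a4, a5, a6, a7⟩ := arith_main m n r S μ κ p hn hnm hr hμ hκ1 hSmn rfl hS
  refine prob_good m n r S a1 hn hnm hSmn p (p * m) rfl a3 rfl a4 U hU (μ * r / m) (by positivity)
    hu a5 V hV (μ * r / n) (by positivity) hv a6 _ ?_
  intro Ω hspec hcol hrow X Y hK1 hK2 hK
  have hβT : βT = Real.sqrt (r * Smax) := by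
    show Real.sqrt (1 * r * Smax) = _
    rw [one_mul]
  have hβ1 : β1 = Real.sqrt (r * Smax) * Real.sqrt (3 * (μ * r / m)) := by
    show βT * Real.sqrt (3 * μ * r / m) = _
    rw [hβT]; congr 2; ring
  have hβ2 : β2 = Real.sqrt (r * Smax) * Real.sqrt (3 * (μ * r / n)) := by
    show βT * Real.sqrt (3 * μ * r / n) = _
    rw [hβT]; congr 2; ring
  have hδ : δ ≤ Smin / (100 * r * κ) := by
    show Smin / (100 * (r : ℝ) ^ ((3 : ℝ) / 2) * κ) ≤ _
    have : (r : ℝ) ≤ (r : ℝ) ^ ((3 : ℝ) / 2) := by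
      conv_lhs => rw [← Real.rpow_one (r : ℝ)]
      exact Real.rpow_le_rpow_of_exponent_le hr1 (by norm_num)
    gcongr
  have hproj : frob (projOmega Ω (M - X * Yᵀ)) ^ 2 =
      ∑ i, ∑ j, (if (i, j) ∈ Ω then (1 : ℝ) else 0) * (M - X * Yᵀ) i j ^ 2 := by
    rw [frob_sq]
    refine Finset.sum_congr rfl fun i _ => Finset.sum_congr rfl fun j _ => ?_
    simp only [projOmega, Matrix.of_apply]
    split_ifs <;> simp
  rw [hproj, hM]
  have hK' : frob (M - X * Yᵀ) ≤ δ := hK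
  rw [hM] at hK'
  exact det_main (fun i j => if (i, j) ∈ Ω then (1 : ℝ) else 0)
    (fun i j => by split_ifs <;> norm_num)
    p (18934 * Real.sqrt (p * m)) (μ * r / m) (μ * r / n) Smin Smax κ a2 (by positivity) hr hs0 rfl
    hκ1 (by positivity) (by positivity) U V hU hV σ hmin.1 hu hv hspec hcol hrow a7 X Y
    (hβT ▸ hK2.1) (hβT ▸ hK2.2) (hβ1 ▸ hK1.1) (hβ2 ▸ hK1.2) (hK'.trans hδ)

end
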